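/- Let (F_n)_{n∈ℕ} together with F_∞ be a monotone (either all increasing or all decreasing) sequence of ℍ-hulls contained in a fixed ℍ-hull F̃ with Im F̃ < ∞ and hcap(F̃) < ∞. If hcap(F_n) → hcap(F_∞), then F_n converges to F_∞ in Carathéodory's sense. -/

import Mathlib

open MeasureTheory Filter

/-- The complex upper half-plane. -/
def UH : Set ℂ := {z | 0 < z.im}

/-- A planar Brownian motion with sample space `Ω`: a family of probability
measures `P w` (the law of Brownian motion started at `w`), with continuous
paths, Gaussian increments and independent increments. -/
structure PlanarBM (Ω : Type*) [MeasurableSpace Ω] where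
  Z : ℝ → Ω → ℂ
  P : ℂ → Measure Ω
  isProb : ∀ w, IsProbabilityMeasure (P w)
  meas : ∀ t, Measurable (Z t)
  start : ∀ w, ∀ᵐ ω ∂P w, Z 0 ω = w
  contPaths : ∀ w, ∀ᵐ ω ∂P w, Continuous fun t => Z t ω
  incrLaw : ∀ (w : ℂ) (s t : ℝ), 0 ≤ s → s ≤ t →
    (P w).map (fun ω => Z t ω - Z s ω) =
      (((ProbabilityTheory.gaussianReal 0 (Real.toNNReal (t - s))).prod
        (ProbabilityTheory.gaussianReal 0 (Real.toNNReal (t - s)))).map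
        fun p : ℝ × ℝ => Complex.equivRealProd.symm p)
  indepIncr : ∀ (w : ℂ) (s t : ℝ), 0 ≤ s → s ≤ t →
    ProbabilityTheory.IndepFun (fun ω => Z t ω - Z s ω)
      (fun ω => fun u : Set.Iic s => Z u.1 ω) (P w)

/-- First hitting time of the set `A` by the path `f` (∞ if never hit). -/
noncomputable def hitTime (f : ℝ → ℂ) (A : Set ℂ) : ENNReal :=
  sInf (ENNReal.ofReal '' {t : ℝ | 0 ≤ t ∧ f t ∈ A})

/-- First exit time of the path `f` from the set `D`. -/
noncomputable def exitTime (f : ℝ → ℂ) (D : Set ℂ) : ENNReal :=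
  hitTime f Dᶜ

/-- The path `f` exits the domain `D` (in finite time) through the set `B`. -/
def exitsInto (f : ℝ → ℂ) (D B : Set ℂ) : Prop :=
  ∃ t : ℝ, 0 ≤ t ∧ ENNReal.ofReal t = exitTime f D ∧ f t ∈ B

/-- Harmonic measure of `B` in `D` seen from `z`: the probability that Brownian
motion started at `z` exits `D` through `B`. -/
noncomputable def Hm {Ω : Type*} [MeasurableSpace Ω] (BM : PlanarBM Ω)
    (D B : Set ℂ) (z : ℂ) : ENNReal :=
  BM.P z {ω | exitsInto (fun t => BM.Z t ω) D B}

/-- `F` is an ℍ-hull: `F ⊆ ℍ`, `F` is relatively closed in ℍ, and `ℍ \ F` is a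
simply connected domain. -/
def IsHHull (F : Set ℂ) : Prop :=
  F ⊆ UH ∧ closure F ∩ UH = F ∧ SimplyConnectedSpace (UH \ F : Set ℂ)

/-- Carathéodory kernel convergence of domains with respect to the point `z₀`. -/
def KernelConvergesTo (D : ℕ → Set ℂ) (Dinf : Set ℂ) (z₀ : ℂ) : Prop :=
  (∀ K : Set ℂ, IsCompact K → K ⊆ Dinf → ∀ᶠ n in Filter.atTop, K ⊆ D n) ∧
  (∀ U : Set ℂ, IsOpen U → IsConnected U → z₀ ∈ U → {n | U ⊆ D n}.Infinite → U ⊆ Dinf)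

open scoped Classical in
/-- The imaginary part of the path `f` at the hitting time of `F`, provided `F`
is hit (in finite time) before the path leaves ℍ; zero otherwise (absorption). -/
noncomputable def imAtHit (f : ℝ → ℂ) (F : Set ℂ) : ℝ :=
  if h : ∃ t : ℝ, 0 ≤ t ∧ ENNReal.ofReal t = hitTime f F ∧ hitTime f F < exitTime f UH
  then (f h.choose).im else 0

/-- `hcap F = a`: the half-plane capacity of `F`, defined by
`hcap F = lim_{y→∞} y E_{iy}[Im Z_{σ_F}]` for absorbed Brownian motion in ℍ. -/
def HasHcap {Ω : Type*} [MeasurableSpace Ω] (BM : PlanarBM Ω) (F : Set ℂ) (a : ℝ) : Prop :=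
  Tendsto
    (fun y : ℝ => y * ∫ ω, imAtHit (fun t => BM.Z t ω) F ∂BM.P ((y : ℂ) * Complex.I))
    atTop (nhds a)

open scoped NNReal ENNReal Topology

/-- The centred isotropic Gaussian law on `ℂ` with variance `v` in each coordinate. -/
noncomputable def gaussianC (v : ℝ≥0) : Measure ℂ :=
  ((ProbabilityTheory.gaussianReal 0 v).prod (ProbabilityTheory.gaussianReal 0 v)).map
    fun p : ℝ × ℝ => Complex.equivRealProd.symm p

lemma measurable_equivRealProd_symm :
    Measurable fun p : ℝ × ℝ => Complex.equivRealProd.symm p :=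
  Complex.measurableEquivRealProd.symm.measurable

instance (v : ℝ≥0) : IsProbabilityMeasure (gaussianC v) :=
  Measure.isProbabilityMeasure_map measurable_equivRealProd_symm.aemeasurable

/-- A path set to zero outside a finite set of times. -/
noncomputable def freezePath (J : Finset ℝ≥0) (φ : ℝ≥0 → ℂ) : ℝ≥0 → ℂ := fun u => if u ∈ J then φ u else 0

lemma freezePath_sup (J : Finset ℝ≥0) (φ : ℝ≥0 → ℂ) (h0 : φ 0 = 0) :
    freezePath J φ (J.sup id) = φ (J.sup id) := by
  rcases J.eq_empty_or_nonempty with rfl | hJ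
  · simp [freezePath, h0]
  · obtain ⟨i, hi, h⟩ := Finset.exists_mem_eq_sup J hJ id
    rw [h]
    simp [freezePath, hi]

lemma freezePath_insert (J : Finset ℝ≥0) (t : ℝ≥0) (φ : ℝ≥0 → ℂ) :
    freezePath (insert t J) φ = Function.update (freezePath J φ) t (φ t) := by
  ext u
  by_cases h : u = t
  · subst h; simp [freezePath]
  · simp [freezePath, h]

namespace PlanarBM

variable {Ω : Type*} [MeasurableSpace Ω] (BM : PlanarBM Ω)

instance (w : ℂ) : IsProbabilityMeasure (BM.P w) := BM.isProb w

/-- The path stopped at time `s`. -/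
def stopZ (s : ℝ≥0) (ω : Ω) : ℝ≥0 → ℂ := fun u => BM.Z (min u s : ℝ≥0) ω

/-- The increments of the path after time `s`. -/
def incZ (s : ℝ≥0) (ω : Ω) : ℝ≥0 → ℂ := fun u => BM.Z (s + u : ℝ≥0) ω - BM.Z s ω

lemma measurable_stopZ (s : ℝ≥0) : Measurable (BM.stopZ s) :=
  measurable_pi_lambda _ fun _ => BM.meas _

lemma measurable_incZ (s : ℝ≥0) : Measurable (BM.incZ s) :=
  measurable_pi_lambda _ fun _ => (BM.meas _).sub (BM.meas _)

lemma map_increment (w : ℂ) (s t : ℝ≥0) :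
    (BM.P w).map (fun ω => BM.Z (s + t : ℝ≥0) ω - BM.Z s ω) = gaussianC t := by
  have h := BM.incrLaw w s (s + t : ℝ≥0) s.2 (by push_cast; linarith [t.2])
  rw [h, gaussianC]
  simp

lemma lintegral_past_increment (w : ℂ) (s t : ℝ≥0) (h : (Set.Iic (s : ℝ) → ℂ) × ℂ → ℝ≥0∞)
    (hh : Measurable h) :
    ∫⁻ ω, h (fun u => BM.Z u.1 ω, BM.Z (s + t : ℝ≥0) ω - BM.Z s ω) ∂BM.P w =
      ∫⁻ ω, ∫⁻ x, h (fun u => BM.Z u.1 ω, x) ∂gaussianC t ∂BM.P w := by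
  have hp : Measurable (fun ω => fun u : Set.Iic (s : ℝ) => BM.Z u.1 ω) :=
    measurable_pi_lambda _ fun u => BM.meas u.1
  have hd : Measurable (fun ω => BM.Z (s + t : ℝ≥0) ω - BM.Z s ω) := (BM.meas _).sub (BM.meas _)
  have hi := (BM.indepIncr w s (s + t : ℝ≥0) s.2 (by push_cast; linarith [t.2])).symm
  rw [ProbabilityTheory.indepFun_iff_map_prod_eq_prod_map_map hp.aemeasurable hd.aemeasurable,
    BM.map_increment] at hi
  have h1 := lintegral_map (μ := BM.P w) hh (hp.prodMk hd)
  rw [hi, lintegral_prod _ hh.aemeasurable,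
    lintegral_map hh.lintegral_prod_right' hp] at h1
  exact h1.symm

lemma lintegral_freeze (J : Finset ℝ≥0) (s : ℝ≥0) (w w' : ℂ)
    (g : (ℝ≥0 → ℂ) × (ℝ≥0 → ℂ) → ℝ≥0∞) (hg : Measurable g) :
    ∫⁻ ω, g (BM.stopZ s ω, freezePath J (BM.incZ s ω)) ∂BM.P w =
      ∫⁻ ω, ∫⁻ ω', g (BM.stopZ s ω, freezePath J (BM.incZ 0 ω')) ∂BM.P w' ∂BM.P w := by
  induction J using Finset.induction_on_max generalizing g with
  | empty =>
    have h0 : ∀ φ : ℝ≥0 → ℂ, freezePath ∅ φ = fun _ => 0 := fun φ => by ext u; simp [freezePath]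
    simp [h0]
  | insert t J hJ ih =>
    set t' := J.sup id with ht'
    have htt : t' ≤ t := Finset.sup_le fun x hx => (hJ x hx).le
    obtain ⟨d, rfl⟩ := exists_add_of_le htt
    have key : ∀ (r : ℝ≥0) (v : ℂ) (f : (ℝ≥0 → ℂ) × (ℝ≥0 → ℂ) → ℝ≥0∞), Measurable f →
        ∫⁻ ω, f (BM.stopZ r ω, freezePath (insert (t' + d) J) (BM.incZ r ω)) ∂BM.P v =
        ∫⁻ ω, ∫⁻ x, f (BM.stopZ r ω, Function.update (freezePath J (BM.incZ r ω)) (t' + d)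
          (freezePath J (BM.incZ r ω) t' + x)) ∂gaussianC d ∂BM.P v := by
      intro r v f hf
      let A : (Set.Iic ((r + t' : ℝ≥0) : ℝ) → ℂ) → (ℝ≥0 → ℂ) := fun p u =>
        p ⟨(min u r : ℝ≥0), by
          have : min u r ≤ r + t' := (min_le_right _ _).trans (by simp)
          exact_mod_cast this⟩
      let B : (Set.Iic ((r + t' : ℝ≥0) : ℝ) → ℂ) → (ℝ≥0 → ℂ) := fun p u =>
        if u ∈ J then p ⟨(r + min u t' : ℝ≥0), by
          have : r + min u t' ≤ r + t' := by gcongr; exact min_le_right _ _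
          exact_mod_cast this⟩ - p ⟨(r : ℝ), by
          have : r ≤ r + t' := by simp
          exact_mod_cast this⟩ else 0
      have hA : Measurable A := measurable_pi_lambda _ fun u => measurable_pi_apply _
      have hB : Measurable B := by
        refine measurable_pi_lambda _ fun u => ?_
        simp only [B]
        split_ifs
        · exact (measurable_pi_apply _).sub (measurable_pi_apply _)
        · exact measurable_const
      have hAe : ∀ ω, A (fun u => BM.Z u.1 ω) = BM.stopZ r ω := fun ω => rfl
      have hBe : ∀ ω, B (fun u => BM.Z u.1 ω) = freezePath J (BM.incZ r ω) := by
        intro ω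
        ext u
        simp only [B, freezePath, incZ]
        split_ifs with hu
        · have : min u t' = u := min_eq_left (Finset.le_sup (f := id) hu)
          rw [this]
        · rfl
      have hup : Measurable fun q : (ℝ≥0 → ℂ) × ℂ =>
          Function.update q.1 (t' + d) (q.1 t' + q.2) := by
        refine measurable_pi_lambda _ fun u => ?_
        by_cases hu : u = t' + d
        · subst hu
          simp only [Function.update_self]
          exact ((measurable_pi_apply _).comp measurable_fst).add measurable_snd
        · simp only [Function.update_of_ne hu]
          exact (measurable_pi_apply _).comp measurable_fst
      have hm : Measurable fun q : (Set.Iic ((r + t' : ℝ≥0) : ℝ) → ℂ) × ℂ =>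
          f (A q.1, Function.update (B q.1) (t' + d) (B q.1 t' + q.2)) :=
        hf.comp ((hA.comp measurable_fst).prodMk
          (hup.comp ((hB.comp measurable_fst).prodMk measurable_snd)))
      have := BM.lintegral_past_increment v (r + t') d _ hm
      simp only [hAe, hBe] at this
      rw [← this]
      refine lintegral_congr fun ω => ?_
      rw [freezePath_insert, freezePath_sup J _ (by simp [incZ])]
      congr 3
      rw [← ht']
      simp [incZ, add_assoc]
    have hup : Measurable fun q : ((ℝ≥0 → ℂ) × (ℝ≥0 → ℂ)) × ℂ =>
        g (q.1.1, Function.update q.1.2 (t' + d) (q.1.2 t' + q.2)) := by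
      refine hg.comp ((measurable_fst.comp measurable_fst).prodMk
        (measurable_pi_lambda _ fun u => ?_))
      by_cases hu : u = t' + d
      · subst hu
        simp only [Function.update_self]
        exact ((measurable_pi_apply _).comp (measurable_snd.comp measurable_fst)).add measurable_snd
      · simp only [Function.update_of_ne hu]
        exact (measurable_pi_apply _).comp (measurable_snd.comp measurable_fst)
    rw [key s w g hg, ih (fun q => ∫⁻ x, g (q.1, Function.update q.2 (t' + d)
      (q.2 t' + x)) ∂gaussianC d) hup.lintegral_prod_right']
    refine lintegral_congr fun ω => ?_
    exact (key 0 w' (fun q => g (BM.stopZ s ω, q.2))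
      (hg.comp (measurable_const.prodMk measurable_snd))).symm

lemma map_stopZ_incZ (s : ℝ≥0) (w w' : ℂ) :
    (BM.P w).map (fun ω => (BM.stopZ s ω, BM.incZ s ω)) =
      ((BM.P w).map (BM.stopZ s)).prod ((BM.P w').map (BM.incZ 0)) := by
  have : IsProbabilityMeasure ((BM.P w).map (BM.stopZ s)) :=
    Measure.isProbabilityMeasure_map (BM.measurable_stopZ s).aemeasurable
  have : IsProbabilityMeasure ((BM.P w').map (BM.incZ 0)) :=
    Measure.isProbabilityMeasure_map (BM.measurable_incZ 0).aemeasurable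
  have hms := BM.measurable_stopZ s
  have hmi := BM.measurable_incZ s
  symm
  refine Measure.prod_eq fun A B hA hB => ?_
  rw [Measure.map_apply (hms.prodMk hmi) (hA.prod hB), Measure.map_apply hms hA,
    Measure.map_apply (BM.measurable_incZ 0) hB]
  let μ : Measure (ℝ≥0 → ℂ) := ((BM.P w).restrict (BM.stopZ s ⁻¹' A)).map (BM.incZ s)
  let ν : Measure (ℝ≥0 → ℂ) := (BM.P w (BM.stopZ s ⁻¹' A)) • ((BM.P w').map (BM.incZ 0))
  have hμν : μ = ν := by
    have gen : ∀ C ∈ measurableCylinders (fun _ : ℝ≥0 => ℂ), μ C = ν C := by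
      intro C hC
      obtain ⟨J, S, hS, rfl⟩ := (mem_measurableCylinders _).1 hC
      have hfr : ∀ φ : ℝ≥0 → ℂ, freezePath J φ ∈ cylinder J S ↔ φ ∈ cylinder J S := by
        intro φ
        simp only [mem_cylinder]
        have : J.restrict (freezePath J φ) = J.restrict φ := by
          ext u; simp [freezePath]
        rw [this]
      have hCm : MeasurableSet (cylinder J S : Set (ℝ≥0 → ℂ)) := hS.cylinder J
      have h := BM.lintegral_freeze J s w w' ((A ×ˢ cylinder J S).indicator 1)
        (measurable_one.indicator (hA.prod hCm))
      have e1 : ∀ ω, (A ×ˢ (cylinder J S)).indicator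
          (1 : (ℝ≥0 → ℂ) × (ℝ≥0 → ℂ) → ℝ≥0∞)
          (BM.stopZ s ω, freezePath J (BM.incZ s ω)) =
          (BM.stopZ s ⁻¹' A ∩ BM.incZ s ⁻¹' cylinder J S).indicator 1 ω := by
        intro ω
        have : (BM.stopZ s ω, freezePath J (BM.incZ s ω)) ∈ A ×ˢ cylinder J S ↔
            ω ∈ BM.stopZ s ⁻¹' A ∩ BM.incZ s ⁻¹' cylinder J S := by
          rw [Set.mem_prod, hfr]; rfl
        by_cases hm : (BM.stopZ s ω, freezePath J (BM.incZ s ω)) ∈ A ×ˢ cylinder J S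
        · rw [Set.indicator_of_mem hm, Set.indicator_of_mem (this.1 hm)]; rfl
        · rw [Set.indicator_of_notMem hm, Set.indicator_of_notMem fun h => hm (this.2 h)]
      have e2 : ∀ ω ω', (A ×ˢ (cylinder J S)).indicator
          (1 : (ℝ≥0 → ℂ) × (ℝ≥0 → ℂ) → ℝ≥0∞)
          (BM.stopZ s ω, freezePath J (BM.incZ 0 ω')) =
          (BM.stopZ s ⁻¹' A).indicator 1 ω * (BM.incZ 0 ⁻¹' cylinder J S).indicator 1 ω' := by
        intro ω ω'
        by_cases h1 : BM.stopZ s ω ∈ A <;> by_cases h2 : BM.incZ 0 ω' ∈ cylinder J S <;>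
          simp [Set.indicator, Set.mem_prod, hfr, h1, h2]
      have m0 : MeasurableSet (BM.incZ 0 ⁻¹' cylinder J S) := BM.measurable_incZ 0 hCm
      simp only [e1, e2] at h
      rw [lintegral_indicator_one ((hms hA).inter (hmi hCm))] at h
      have : ∀ ω, ∫⁻ ω', (BM.stopZ s ⁻¹' A).indicator (1 : Ω → ℝ≥0∞) ω *
          (BM.incZ 0 ⁻¹' cylinder J S).indicator 1 ω' ∂BM.P w' =
          (BM.stopZ s ⁻¹' A).indicator (1 : Ω → ℝ≥0∞) ω *
            BM.P w' (BM.incZ 0 ⁻¹' cylinder J S) := by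
        intro ω
        rw [lintegral_const_mul _ (measurable_one.indicator m0), lintegral_indicator_one m0]
      simp only [this] at h
      rw [lintegral_mul_const _ (measurable_one.indicator (hms hA)),
        lintegral_indicator_one (hms hA)] at h
      simp only [μ, ν]
      rw [Measure.map_apply hmi hCm, Measure.restrict_apply (hmi hCm), Measure.smul_apply,
        Measure.map_apply (BM.measurable_incZ 0) hCm, smul_eq_mul, Set.inter_comm]
      exact h
    have : IsFiniteMeasure μ := by
      simp only [μ]; infer_instance
    refine ext_of_generate_finite _ generateFrom_measurableCylinders.symm
      isPiSystem_measurableCylinders gen ?_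
    exact gen _ (univ_mem_measurableCylinders _)
  have := congrArg (fun m : Measure (ℝ≥0 → ℂ) => m B) hμν
  simp only [μ, ν] at this
  rw [Measure.map_apply hmi hB, Measure.restrict_apply (hmi hB), Measure.smul_apply,
    Measure.map_apply (BM.measurable_incZ 0) hB, smul_eq_mul, Set.inter_comm] at this
  exact this

end PlanarBM

/-- Continuous planar paths, with the σ-algebra generated by the evaluations. -/
abbrev CPath := {f : ℝ≥0 → ℂ // Continuous f}

namespace CPath

/-- The path frozen at time `s`. -/
noncomputable def freeze (s : ℝ≥0) (f : CPath) : CPath :=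
  ⟨fun u => f.1 (min u s), f.2.comp (by fun_prop)⟩

/-- The path after time `s`. -/
noncomputable def shift (s : ℝ≥0) (f : CPath) : CPath :=
  ⟨fun u => f.1 (s + u), f.2.comp (by fun_prop)⟩

/-- The increments of the path after time `s`. -/
noncomputable def inc (s : ℝ≥0) (f : CPath) : CPath :=
  ⟨fun u => f.1 (s + u) - f.1 s, (f.2.comp (by fun_prop)).sub continuous_const⟩

/-- The translated path. -/
noncomputable def transl (z : ℂ) (f : CPath) : CPath :=
  ⟨fun u => z + f.1 u, continuous_const.add f.2⟩

lemma measurable_eval (t : ℝ≥0) : Measurable fun f : CPath => f.1 t :=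
  (measurable_pi_apply t).comp measurable_subtype_coe

lemma measurable_mk {α : Type*} [MeasurableSpace α] {F : α → CPath}
    (h : ∀ u, Measurable fun a => (F a).1 u) : Measurable F :=
  (measurable_pi_lambda (fun a => (F a).1) h).subtype_mk (h := fun a => (F a).2)

lemma measurable_freeze (s : ℝ≥0) : Measurable (freeze s) :=
  measurable_mk fun _ => measurable_eval _

lemma measurable_shift (s : ℝ≥0) : Measurable (shift s) :=
  measurable_mk fun _ => measurable_eval _

lemma measurable_inc (s : ℝ≥0) : Measurable (inc s) :=
  measurable_mk fun _ => (measurable_eval _).sub (measurable_eval _)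

lemma measurable_transl_uncurry : Measurable fun p : ℂ × CPath => transl p.1 p.2 :=
  measurable_mk fun _ => measurable_fst.add ((measurable_eval _).comp measurable_snd)

lemma measurable_transl (z : ℂ) : Measurable (transl z) :=
  measurable_transl_uncurry.comp (measurable_const.prodMk measurable_id)

lemma shift_eq (s : ℝ≥0) (f : CPath) : shift s f = transl (f.1 s) (inc s f) := by
  apply Subtype.ext; ext u; simp [shift, transl, inc]

lemma freeze_freeze {s t : ℝ≥0} (h : s ≤ t) (f : CPath) : freeze s (freeze t f) = freeze s f := by
  apply Subtype.ext; ext u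
  have : min (min u s) t = min u s := min_eq_left ((min_le_right _ _).trans h)
  simp [freeze, this]

lemma freeze_apply {s u : ℝ≥0} (h : u ≤ s) (f : CPath) : (freeze s f).1 u = f.1 u := by
  simp [freeze, h]

lemma shift_apply (s u : ℝ≥0) (f : CPath) : (shift s f).1 u = f.1 (s + u) := rfl

lemma inc_apply (s u : ℝ≥0) (f : CPath) : (inc s f).1 u = f.1 (s + u) - f.1 s := rfl

end CPath

namespace PlanarBM

open CPath

variable {Ω : Type*} [MeasurableSpace Ω] (BM : PlanarBM Ω)

open scoped Classical in
/-- The sample path, replaced by a constant path where it is not continuous. -/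
noncomputable def pathOf (ω : Ω) : CPath :=
  if h : Continuous fun t : ℝ≥0 => BM.Z t ω then ⟨fun t => BM.Z t ω, h⟩
  else ⟨fun _ => 0, continuous_const⟩

lemma ae_pathOf (w : ℂ) : ∀ᵐ ω ∂BM.P w, (BM.pathOf ω).1 = fun t : ℝ≥0 => BM.Z t ω := by
  filter_upwards [BM.contPaths w] with ω hω
  have : Continuous fun t : ℝ≥0 => BM.Z t ω := hω.comp NNReal.continuous_coe
  simp [pathOf, this]

lemma aemeasurable_pathOf (w : ℂ) : AEMeasurable BM.pathOf (BM.P w) := by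
  classical
  have h0 := BM.ae_pathOf w
  obtain ⟨E, hE, hEm, hE0⟩ := exists_measurable_superset_of_null (ae_iff.1 h0)
  refine ⟨fun ω => if ω ∈ E then ⟨fun _ => 0, continuous_const⟩ else BM.pathOf ω, ?_, ?_⟩
  · refine measurable_mk fun u => ?_
    have : (fun ω => (if ω ∈ E then (⟨fun _ => 0, continuous_const⟩ : CPath)
        else BM.pathOf ω).1 u) = fun ω => if ω ∈ E then 0 else BM.Z u ω := by
      ext ω
      split_ifs with h
      · rfl
      · have : (BM.pathOf ω).1 = fun t : ℝ≥0 => BM.Z t ω := by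
          by_contra hne
          exact h (hE hne)
        rw [this]
    rw [this]
    exact Measurable.ite hEm measurable_const (BM.meas _)
  · have : ∀ᵐ ω ∂BM.P w, ω ∉ E := measure_eq_zero_iff_ae_notMem.1 hE0
    filter_upwards [this] with ω hω
    simp [hω]

/-- The law of the path of the Brownian motion started at `w`. -/
noncomputable def law (w : ℂ) : Measure CPath := (BM.P w).map BM.pathOf

instance (w : ℂ) : IsProbabilityMeasure (BM.law w) :=
  Measure.isProbabilityMeasure_map (BM.aemeasurable_pathOf w)

/-- The law of the path of the Brownian motion, relative to its starting point. -/
noncomputable def wiener : Measure CPath := (BM.law 0).map (inc 0)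

instance : IsProbabilityMeasure BM.wiener :=
  Measure.isProbabilityMeasure_map (measurable_inc 0).aemeasurable

lemma law_start (w : ℂ) : ∀ᵐ f ∂BM.law w, f.1 0 = w := by
  rw [law, ae_map_iff (BM.aemeasurable_pathOf w)
    (measurableSet_eq_fun (measurable_eval 0) measurable_const)]
  filter_upwards [BM.ae_pathOf w, BM.start w] with ω h1 h2
  rw [h1]
  simpa using h2

lemma map_freeze_inc (s : ℝ≥0) (w : ℂ) :
    (BM.law w).map (fun f => (freeze s f, inc s f)) =
      ((BM.law w).map (freeze s)).prod BM.wiener := by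
  symm
  have : IsProbabilityMeasure ((BM.law w).map (freeze s)) :=
    Measure.isProbabilityMeasure_map (measurable_freeze s).aemeasurable
  refine Measure.prod_eq fun A B hA hB => ?_
  rw [Measure.map_apply ((measurable_freeze s).prodMk (measurable_inc s)) (hA.prod hB),
    Measure.map_apply (measurable_freeze s) hA, wiener, Measure.map_apply (measurable_inc 0) hB]
  obtain ⟨A', hA', rfl⟩ := hA
  obtain ⟨B', hB', rfl⟩ := hB
  have e := BM.map_stopZ_incZ s w 0
  have h1 := congrArg (fun m : Measure ((ℝ≥0 → ℂ) × (ℝ≥0 → ℂ)) => m (A' ×ˢ B')) e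
  simp only [Measure.prod_prod] at h1
  rw [Measure.map_apply ((BM.measurable_stopZ s).prodMk (BM.measurable_incZ s)) (hA'.prod hB'),
    Measure.map_apply (BM.measurable_stopZ s) hA',
    Measure.map_apply (BM.measurable_incZ 0) hB'] at h1
  have hAm : MeasurableSet (Subtype.val ⁻¹' A' : Set CPath) := measurable_subtype_coe hA'
  have hBm : MeasurableSet (Subtype.val ⁻¹' B' : Set CPath) := measurable_subtype_coe hB'
  rw [law, law, Measure.map_apply_of_aemeasurable (BM.aemeasurable_pathOf w)
      (((measurable_freeze s).prodMk (measurable_inc s)) (hAm.prod hBm)),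
    Measure.map_apply_of_aemeasurable (BM.aemeasurable_pathOf w) (measurable_freeze s hAm),
    Measure.map_apply_of_aemeasurable (BM.aemeasurable_pathOf 0) (measurable_inc 0 hBm)]
  convert! h1 using 1
  · refine measure_congr ?_
    filter_upwards [BM.ae_pathOf w] with ω hω
    refine propext ?_
    change (freeze s (BM.pathOf ω)).1 ∈ A' ∧ (inc s (BM.pathOf ω)).1 ∈ B' ↔
      BM.stopZ s ω ∈ A' ∧ BM.incZ s ω ∈ B'
    simp only [freeze, inc, hω]
    rfl
  · congr 1
    · refine measure_congr ?_
      filter_upwards [BM.ae_pathOf w] with ω hω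
      refine propext ?_
      change (freeze s (BM.pathOf ω)).1 ∈ A' ↔ BM.stopZ s ω ∈ A'
      simp only [freeze, hω]
      rfl
    · refine measure_congr ?_
      filter_upwards [BM.ae_pathOf 0] with ω hω
      refine propext ?_
      change (inc 0 (BM.pathOf ω)).1 ∈ B' ↔ BM.incZ 0 ω ∈ B'
      simp only [inc, hω]
      rfl

lemma map_inc (s : ℝ≥0) (w : ℂ) : (BM.law w).map (inc s) = BM.wiener := by
  have h := congrArg Measure.snd (BM.map_freeze_inc s w)
  have : IsProbabilityMeasure ((BM.law w).map (freeze s)) :=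
    Measure.isProbabilityMeasure_map (measurable_freeze s).aemeasurable
  rw [Measure.snd_prod, Measure.snd_map_prodMk (measurable_freeze s)] at h
  exact h

lemma law_eq_map_transl (w : ℂ) : BM.law w = BM.wiener.map (transl w) := by
  rw [← BM.map_inc 0 w, Measure.map_map (measurable_transl w) (measurable_inc 0)]
  conv_lhs => rw [← Measure.map_id (μ := BM.law w)]
  refine Measure.map_congr ?_
  filter_upwards [BM.law_start w] with f hf
  apply Subtype.ext; ext u
  simp [transl, inc, hf]

lemma lintegral_law (w : ℂ) {g : CPath → ℝ≥0∞} (hg : Measurable g) :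
    ∫⁻ f, g f ∂BM.law w = ∫⁻ f, g (transl w f) ∂BM.wiener := by
  rw [law_eq_map_transl, lintegral_map hg (measurable_transl w)]

lemma measurable_lintegral_law {α : Type*} [MeasurableSpace α] {u : α → ℂ} (hu : Measurable u)
    {g : α × CPath → ℝ≥0∞} (hg : Measurable g) :
    Measurable fun a => ∫⁻ f, g (a, f) ∂BM.law (u a) := by
  have : ∀ a, ∫⁻ f, g (a, f) ∂BM.law (u a) = ∫⁻ f, g (a, transl (u a) f) ∂BM.wiener :=
    fun a => BM.lintegral_law _ (hg.comp (measurable_const.prodMk measurable_id))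
  simp only [this]
  exact Measurable.lintegral_prod_right' (f := fun p : α × CPath => g (p.1, transl (u p.1) p.2))
    (hg.comp (measurable_fst.prodMk (measurable_transl_uncurry.comp
      ((hu.comp measurable_fst).prodMk measurable_snd))))

/-- The Markov property at a deterministic time. -/
lemma lintegral_markov (s : ℝ≥0) (w : ℂ) {g : CPath × CPath → ℝ≥0∞} (hg : Measurable g) :
    ∫⁻ f, g (freeze s f, shift s f) ∂BM.law w =
      ∫⁻ f, ∫⁻ h, g (freeze s f, h) ∂BM.law (f.1 s) ∂BM.law w := by
  have hG : Measurable fun p : CPath × CPath => g (p.1, transl (p.1.1 s) p.2) :=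
    hg.comp (measurable_fst.prodMk (measurable_transl_uncurry.comp
      (((measurable_eval s).comp measurable_fst).prodMk measurable_snd)))
  have h1 := lintegral_map (μ := BM.law w) hG ((measurable_freeze s).prodMk (measurable_inc s))
  rw [map_freeze_inc, lintegral_prod _ hG.aemeasurable,
    lintegral_map hG.lintegral_prod_right' (measurable_freeze s)] at h1
  have e1 : ∀ f : CPath, (freeze s f).1 s = f.1 s := fun f => freeze_apply le_rfl f
  simp only [e1, ← shift_eq] at h1
  rw [← h1]
  refine lintegral_congr fun f => ?_
  exact (BM.lintegral_law _ (hg.comp (measurable_const.prodMk measurable_id))).symm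

lemma map_eval_wiener (t : ℝ≥0) : BM.wiener.map (fun f => f.1 t) = gaussianC t := by
  rw [wiener, law, Measure.map_map (measurable_eval t) (measurable_inc 0),
    AEMeasurable.map_map_of_aemeasurable
      ((measurable_eval t).comp (measurable_inc 0)).aemeasurable (BM.aemeasurable_pathOf 0),
    ← BM.map_increment 0 0 t]
  refine Measure.map_congr ?_
  filter_upwards [BM.ae_pathOf 0] with ω hω
  simp [inc, hω]

lemma map_eval (w : ℂ) (t : ℝ≥0) :
    (BM.law w).map (fun f => f.1 t) = (gaussianC t).map (fun x => w + x) := by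
  rw [law_eq_map_transl, Measure.map_map (measurable_eval t) (measurable_transl w),
    ← BM.map_eval_wiener t, Measure.map_map (measurable_const_add w) (measurable_eval t)]
  rfl

end PlanarBM

namespace CPath

/-- The paths that stay in `D` up to time `t`. -/
def Stay (D : Set ℂ) (t : ℝ≥0) : Set CPath := {f | ∀ s ≤ t, f.1 s ∈ D}

lemma stay_mono {D D' : Set ℂ} (h : D ⊆ D') (t : ℝ≥0) : Stay D t ⊆ Stay D' t :=
  fun _ hf s hs => h (hf s hs)

lemma stay_anti (D : Set ℂ) {s t : ℝ≥0} (h : s ≤ t) : Stay D t ⊆ Stay D s :=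
  fun _ hf u hu => hf u (hu.trans h)

lemma freeze_mem_stay {D : Set ℂ} {s t : ℝ≥0} (h : t ≤ s) (f : CPath) :
    freeze s f ∈ Stay D t ↔ f ∈ Stay D t :=
  forall₂_congr fun u hu => by rw [freeze_apply (hu.trans h)]

lemma mem_stay_add {D : Set ℂ} {s t : ℝ≥0} {f : CPath} :
    f ∈ Stay D (s + t) ↔ f ∈ Stay D s ∧ shift s f ∈ Stay D t := by
  constructor
  · exact fun h => ⟨stay_anti D (by simp) h, fun u hu => h _ (by gcongr)⟩
  · rintro ⟨h1, h2⟩ u hu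
    rcases le_total u s with hs | hs
    · exact h1 u hs
    · have := h2 (u - s) (tsub_le_iff_left.2 hu)
      simpa [shift_apply, add_tsub_cancel_of_le hs] using this

lemma measurableSet_stay {D : Set ℂ} (hD : IsOpen D) (t : ℝ≥0) : MeasurableSet (Stay D t) := by
  have key : Stay D t = ⋃ n : ℕ, ⋂ k : ℕ, {f : CPath | ((n : ℝ≥0∞) + 1)⁻¹ ≤
      Metric.infEDist (f.1 (min (TopologicalSpace.denseSeq ℝ≥0 k) t)) Dᶜ} := by
    ext f
    simp only [Set.mem_iUnion, Set.mem_iInter, Set.mem_ofPred_eq]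
    constructor
    · intro hf
      have hc : IsCompact (Set.Iic t) := by
        rw [← Set.Icc_bot]; exact isCompact_Icc
      obtain ⟨s, hs, hmin⟩ := hc.exists_isMinOn ⟨t, Set.mem_Iic.2 le_rfl⟩
        ((Metric.continuous_infEDist (s := Dᶜ)).comp f.2).continuousOn
      have hpos : Metric.infEDist (f.1 s) Dᶜ ≠ 0 := by
        intro h0
        rw [← Metric.mem_closure_iff_infEDist_zero, hD.isClosed_compl.closure_eq] at h0
        exact h0 (hf s hs)
      obtain ⟨n, hn⟩ := ENNReal.exists_inv_nat_lt hpos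
      refine ⟨n, fun k => ?_⟩
      refine le_trans (ENNReal.inv_le_inv.2 le_self_add) (hn.le.trans ?_)
      exact hmin (Set.mem_Iic.2 (min_le_right _ _))
    · rintro ⟨n, hn⟩ s hs
      have hcl : IsClosed {u : ℝ≥0 | ((n : ℝ≥0∞) + 1)⁻¹ ≤
          Metric.infEDist (f.1 (min u t)) Dᶜ} :=
        isClosed_le continuous_const
          (Metric.continuous_infEDist.comp (f.2.comp (continuous_id.min continuous_const)))
      have hd := (TopologicalSpace.denseRange_denseSeq ℝ≥0).closure_eq
      have : s ∈ closure (Set.range (TopologicalSpace.denseSeq ℝ≥0)) := by rw [hd]; trivial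
      have h2 := closure_minimal (Set.range_subset_iff.2 hn) hcl this
      simp only [Set.mem_ofPred_eq, min_eq_left hs] at h2
      by_contra hnot
      rw [Metric.infEDist_zero_of_mem (s := Dᶜ) hnot] at h2
      simp at h2
  rw [key]
  refine MeasurableSet.iUnion fun n => MeasurableSet.iInter fun k => ?_
  exact measurableSet_le measurable_const
    (Metric.continuous_infEDist.measurable.comp (measurable_eval _))

end CPath

namespace PlanarBM

open CPath

variable {Ω : Type*} [MeasurableSpace Ω] (BM : PlanarBM Ω)

lemma setLIntegral_shift (s : ℝ≥0) (z : ℂ) {A : Set CPath} (hA : MeasurableSet A)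
    (hAs : ∀ f, freeze s f ∈ A ↔ f ∈ A) {g : CPath → ℝ≥0∞} (hg : Measurable g) :
    ∫⁻ f in A, g (shift s f) ∂BM.law z =
      ∫⁻ f in A, ∫⁻ h, g h ∂BM.law (f.1 s) ∂BM.law z := by
  have h := BM.lintegral_markov s z
    (g := fun p => A.indicator (fun _ => (1 : ℝ≥0∞)) p.1 * g p.2)
    (((measurable_const.indicator hA).comp measurable_fst).mul (hg.comp measurable_snd))
  rw [← lintegral_indicator hA, ← lintegral_indicator hA]
  convert! h using 1
  · refine lintegral_congr fun f => ?_
    by_cases hf : f ∈ A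
    · simp [hf, (hAs f).2 hf]
    · simp [hf, mt (hAs f).1 hf]
  · refine lintegral_congr fun f => ?_
    by_cases hf : f ∈ A
    · simp [hf, (hAs f).2 hf]
    · simp [hf, mt (hAs f).1 hf]

/-- The law at time `t` of the Brownian motion started at `z` and killed on leaving `D`. -/
noncomputable def killed (D : Set ℂ) (t : ℝ≥0) (z : ℂ) : Measure ℂ :=
  ((BM.law z).restrict (Stay D t)).map fun f => f.1 t

lemma killed_apply (D : Set ℂ) (t : ℝ≥0) (z : ℂ) {A : Set ℂ} (hA : MeasurableSet A) :
    BM.killed D t z A = BM.law z ((fun f => f.1 t) ⁻¹' A ∩ Stay D t) := by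
  rw [killed, Measure.map_apply (measurable_eval t) hA,
    Measure.restrict_apply (measurable_eval t hA)]

lemma killed_mono {D D' : Set ℂ} (h : D ⊆ D') (t : ℝ≥0) (z : ℂ) :
    BM.killed D t z ≤ BM.killed D' t z :=
  Measure.map_mono (Measure.restrict_mono (stay_mono h t) le_rfl) (measurable_eval t)

lemma setLIntegral_stay_shift {D : Set ℂ} (hD : IsOpen D) (s : ℝ≥0) (z : ℂ)
    {g : CPath → ℝ≥0∞} (hg : Measurable g) :
    ∫⁻ f in Stay D s, g (shift s f) ∂BM.law z =
      ∫⁻ x, ∫⁻ h, g h ∂BM.law x ∂BM.killed D s z := by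
  rw [BM.setLIntegral_shift s z (measurableSet_stay hD s) (freeze_mem_stay le_rfl) hg, killed,
    lintegral_map (f := fun x => ∫⁻ h, g h ∂BM.law x)
      (BM.measurable_lintegral_law (g := fun p : ℂ × CPath => g p.2) measurable_id
        (hg.comp measurable_snd)) (measurable_eval s)]

lemma killed_add {D : Set ℂ} (hD : IsOpen D) (s t : ℝ≥0) (z : ℂ) {A : Set ℂ}
    (hA : MeasurableSet A) :
    BM.killed D (s + t) z A = ∫⁻ x, BM.killed D t x A ∂BM.killed D s z := by
  have hm : MeasurableSet ((fun f : CPath => f.1 t) ⁻¹' A ∩ Stay D t) :=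
    (measurable_eval t hA).inter (measurableSet_stay hD t)
  have h := BM.setLIntegral_stay_shift hD s z
    (g := ((fun f : CPath => f.1 t) ⁻¹' A ∩ Stay D t).indicator 1)
    (measurable_one.indicator hm)
  simp only [lintegral_indicator_one hm, ← BM.killed_apply D t _ hA] at h
  rw [← h, BM.killed_apply D _ z hA]
  rw [← lintegral_indicator (measurableSet_stay hD s), ← lintegral_indicator_one
    ((measurable_eval _ hA).inter (measurableSet_stay hD _))]
  refine lintegral_congr fun f => ?_
  have e1 : f ∈ (fun f : CPath => f.1 (s + t)) ⁻¹' A ∩ Stay D (s + t) ↔ f ∈ Stay D s ∧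
      shift s f ∈ (fun f : CPath => f.1 t) ⁻¹' A ∩ Stay D t := by
    rw [Set.mem_inter_iff, Set.mem_inter_iff, mem_stay_add]
    change _ ∧ _ ↔ _ ∧ f.1 (s + t) ∈ A ∧ _
    rw [Set.mem_preimage]
    tauto
  by_cases h1 : f ∈ Stay D s
  · by_cases h2 : shift s f ∈ (fun f : CPath => f.1 t) ⁻¹' A ∩ Stay D t
    · rw [Set.indicator_of_mem (e1.2 ⟨h1, h2⟩), Set.indicator_of_mem h1, Set.indicator_of_mem h2]
      rfl
    · rw [Set.indicator_of_notMem (fun h => h2 (e1.1 h).2), Set.indicator_of_mem h1,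
        Set.indicator_of_notMem h2]
  · rw [Set.indicator_of_notMem (fun h => h1 (e1.1 h).1), Set.indicator_of_notMem h1]

/-- If the killed kernels of `D` dominate Lebesgue measure from `p` to `q` and from `q` to `r`,
they do so from `p` to `r`. -/
lemma le_killed_add {D : Set ℂ} (hD : IsOpen D) {s t : ℝ≥0} {z : ℂ} {V W V' : Set ℂ} {c d : ℝ≥0∞}
    (hV' : MeasurableSet V') (hV : V' ⊆ V) (h1 : c • volume.restrict V ≤ BM.killed D s z)
    (h2 : ∀ x ∈ V', d • volume.restrict W ≤ BM.killed D t x) :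
    (c * volume V' * d) • volume.restrict W ≤ BM.killed D (s + t) z := by
  refine Measure.le_iff.2 fun A hA => ?_
  rw [BM.killed_add hD s t z hA, Measure.smul_apply, smul_eq_mul]
  refine le_trans ?_ (lintegral_mono' h1 le_rfl)
  rw [lintegral_smul_measure, smul_eq_mul, mul_assoc, mul_assoc, mul_comm (volume V')]
  gcongr
  rw [← setLIntegral_const]
  refine le_trans (setLIntegral_mono' hV' (fun x hx => ?_)) (lintegral_mono_set hV)
  exact Measure.le_iff.1 (h2 x hx) A hA

end PlanarBM

namespace CPath

/-- The first hitting time of `C` (zero if `C` is never hit). -/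
noncomputable def hitT (C : Set ℂ) (f : CPath) : ℝ≥0 := sInf {s | f.1 s ∈ C}

lemma notMem_stay {C : Set ℂ} {t : ℝ≥0} {f : CPath} :
    f ∉ Stay Cᶜ t ↔ ∃ s ≤ t, f.1 s ∈ C := by
  simp [Stay]

lemma hitT_le {C : Set ℂ} {t : ℝ≥0} {f : CPath} (h : f.1 t ∈ C) : hitT C f ≤ t :=
  csInf_le (OrderBot.bddBelow _) h

lemma apply_hitT {C : Set ℂ} (hC : IsClosed C) {t : ℝ≥0} {f : CPath} (h : f ∉ Stay Cᶜ t) :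
    f.1 (hitT C f) ∈ C := by
  obtain ⟨s, -, hs⟩ := notMem_stay.1 h
  exact (hC.preimage f.2).csInf_mem ⟨s, hs⟩ (OrderBot.bddBelow _)

lemma mem_stay_iff_lt {C : Set ℂ} (hC : IsClosed C) {t u : ℝ≥0} {f : CPath} (h : f ∉ Stay Cᶜ t) :
    f ∈ Stay Cᶜ u ↔ u < hitT C f := by
  constructor
  · intro hu
    by_contra! hle
    exact hu _ hle (apply_hitT hC h)
  · intro hu s hs hsC
    exact absurd (hitT_le hsC) (not_le.2 (hs.trans_lt hu))

lemma apply_hitT_mem_frontier {C : Set ℂ} (hC : IsClosed C) {t : ℝ≥0} {f : CPath}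
    (h : f ∉ Stay Cᶜ t) (h0 : f.1 0 ∉ C) : f.1 (hitT C f) ∈ frontier C := by
  have hpos : 0 < hitT C f := by
    rcases eq_zero_or_pos (hitT C f) with h1 | h1
    · exact absurd (h1 ▸ apply_hitT hC h) h0
    · exact h1
  rw [frontier_eq_closure_inter_closure]
  refine ⟨subset_closure (apply_hitT hC h), ?_⟩
  have hmem : hitT C f ∈ closure (Set.Iio (hitT C f)) := by
    rw [closure_Iio' (a := hitT C f) ⟨0, hpos⟩]; exact Set.mem_Iic.2 le_rfl
  refine map_mem_closure f.2 hmem fun s hs hsC => ?_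
  exact absurd (hitT_le hsC) (not_le.2 hs)

/-- The grid time `t k / (n + 1)`. -/
noncomputable def grid (t : ℝ≥0) (n k : ℕ) : ℝ≥0 := t * k / (n + 1)

lemma grid_last (t : ℝ≥0) (n : ℕ) : grid t n (n + 1) = t := by
  unfold grid
  push_cast
  field_simp

lemma grid_mono (t : ℝ≥0) (n : ℕ) : Monotone (grid t n) := fun i j h => by
  unfold grid
  gcongr

open scoped Classical in
/-- The index of the first grid time at which `C` has been hit. -/
noncomputable def gridIdx (C : Set ℂ) (t : ℝ≥0) (n : ℕ) (f : CPath) : ℕ :=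
  Nat.find (p := fun k => f ∉ Stay Cᶜ (grid t n k) ∨ k = n + 1) ⟨n + 1, Or.inr rfl⟩

lemma gridIdx_le (C : Set ℂ) (t : ℝ≥0) (n : ℕ) (f : CPath) : gridIdx C t n f ≤ n + 1 := by
  classical
  exact Nat.find_min' _ (Or.inr rfl)

lemma gridIdx_le_of_notMem {C : Set ℂ} {t : ℝ≥0} {n k : ℕ} {f : CPath}
    (h : f ∉ Stay Cᶜ (grid t n k)) : gridIdx C t n f ≤ k := by
  classical
  exact Nat.find_min' _ (Or.inl h)

lemma measurable_gridIdx {C : Set ℂ} (hC : IsClosed C) (t : ℝ≥0) (n : ℕ) :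
    Measurable (gridIdx C t n) := by
  classical
  unfold gridIdx
  refine measurable_find (p := fun (f : CPath) k => f ∉ Stay Cᶜ (grid t n k) ∨ k = n + 1) _
    fun k => ?_
  by_cases hk : k = n + 1
  · simp [hk]
  · simp only [hk, or_false]
    exact (measurableSet_stay hC.isOpen_compl _).compl

lemma notMem_stay_gridIdx {C : Set ℂ} {t : ℝ≥0} (n : ℕ) {f : CPath} (h : f ∉ Stay Cᶜ t) :
    f ∉ Stay Cᶜ (grid t n (gridIdx C t n f)) := by
  classical
  rcases Nat.find_spec (p := fun k => f ∉ Stay Cᶜ (grid t n k) ∨ k = n + 1) ⟨n + 1, Or.inr rfl⟩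
    with h1 | h1
  · exact h1
  · change gridIdx C t n f = n + 1 at h1
    rwa [h1, grid_last]

lemma mem_stay_of_lt_gridIdx {C : Set ℂ} {t : ℝ≥0} {n k : ℕ} {f : CPath}
    (h : k < gridIdx C t n f) : f ∈ Stay Cᶜ (grid t n k) := by
  classical
  have := Nat.find_min (p := fun k => f ∉ Stay Cᶜ (grid t n k) ∨ k = n + 1)
    ⟨n + 1, Or.inr rfl⟩ h
  push Not at this
  exact this.1

lemma tendsto_grid {C : Set ℂ} (hC : IsClosed C) {t : ℝ≥0} {f : CPath} (h : f ∉ Stay Cᶜ t) :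
    Tendsto (fun n => grid t n (gridIdx C t n f)) atTop (𝓝 (hitT C f)) := by
  have hlow : ∀ n, hitT C f ≤ grid t n (gridIdx C t n f) := fun n =>
    not_lt.1 (mt (mem_stay_iff_lt hC h).2 (notMem_stay_gridIdx n h))
  have hup : ∀ n : ℕ, grid t n (gridIdx C t n f) ≤ hitT C f + t / (n + 1) := by
    intro n
    rcases Nat.eq_zero_or_pos (gridIdx C t n f) with h0 | h0
    · rw [h0]; simp [grid]
    · obtain ⟨k, hk⟩ := Nat.exists_eq_succ_of_ne_zero h0.ne'
      have := (mem_stay_iff_lt hC h).1 (mem_stay_of_lt_gridIdx (k := k) (by rw [hk]; simp))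
      calc grid t n (gridIdx C t n f) = grid t n k + t / (n + 1) := by
            rw [hk]; unfold grid; push_cast; rw [← add_div]; ring
        _ ≤ _ := by gcongr
  refine tendsto_of_tendsto_of_tendsto_of_le_of_le tendsto_const_nhds ?_ hlow hup
  have h1 : Tendsto (fun n : ℕ => t / ((n : ℝ≥0) + 1)) atTop (𝓝 0) := by
    rw [← NNReal.tendsto_coe]
    push_cast
    have := tendsto_one_div_add_atTop_nhds_zero_nat (𝕜 := ℝ)
    simpa [div_eq_mul_inv] using this.const_mul (t : ℝ)
  simpa using tendsto_const_nhds.add h1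

/-- The value of the path when it first hits `C`, set to zero if this does not happen
before time `t`. -/
noncomputable def hitVal (C : Set ℂ) (t : ℝ≥0) : CPath → ℂ :=
  (Stay Cᶜ t)ᶜ.indicator fun f => f.1 (hitT C f)

lemma measurable_gridVal {C : Set ℂ} (hC : IsClosed C) (t : ℝ≥0) (n : ℕ) :
    Measurable fun f : CPath => f.1 (grid t n (gridIdx C t n f)) := by
  have : Measurable fun p : CPath × ℕ => p.1.1 (grid t n p.2) :=
    measurable_from_prod_countable_left fun k => measurable_eval (grid t n k)
  exact this.comp (measurable_id.prodMk (measurable_gridIdx hC t n))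

lemma tendsto_gridVal {C : Set ℂ} (hC : IsClosed C) {t : ℝ≥0} {f : CPath} (h : f ∉ Stay Cᶜ t) :
    Tendsto (fun n => f.1 (grid t n (gridIdx C t n f))) atTop (𝓝 (hitVal C t f)) := by
  rw [hitVal, Set.indicator_of_mem (show f ∈ (Stay Cᶜ t)ᶜ from h)]
  exact (f.2.tendsto _).comp (tendsto_grid hC h)

lemma measurable_hitVal {C : Set ℂ} (hC : IsClosed C) (t : ℝ≥0) : Measurable (hitVal C t) := by
  have hm := (measurableSet_stay hC.isOpen_compl t).compl
  refine measurable_of_tendsto_metrizable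
    (fun n => (measurable_gridVal hC t n).indicator hm) ?_
  rw [tendsto_pi_nhds]
  intro f
  by_cases hf : f ∈ (Stay Cᶜ t)ᶜ
  · simp only [Set.indicator_of_mem hf]
    exact tendsto_gridVal hC hf
  · simp only [hitVal, Set.indicator_of_notMem hf]
    exact tendsto_const_nhds

end CPath

namespace PlanarBM

open CPath

variable {Ω : Type*} [MeasurableSpace Ω] (BM : PlanarBM Ω)

lemma setLIntegral_increment {s t : ℝ≥0} (hst : s ≤ t) (z : ℂ) {A : Set CPath}
    (hA : MeasurableSet A) (hAs : ∀ f, freeze s f ∈ A ↔ f ∈ A) {g : ℂ × ℂ → ℝ≥0∞}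
    (hg : Measurable g) :
    ∫⁻ f in A, g (f.1 s, f.1 t - f.1 s) ∂BM.law z =
      ∫⁻ f in A, ∫⁻ y, g (f.1 s, y) ∂gaussianC (t - s) ∂BM.law z := by
  have hG : Measurable fun p : CPath × CPath =>
      A.indicator (fun _ => (1 : ℝ≥0∞)) p.1 * g (p.1.1 s, p.2.1 (t - s)) :=
    ((measurable_const.indicator hA).comp measurable_fst).mul
      (hg.comp (((measurable_eval s).comp measurable_fst).prodMk
        ((measurable_eval _).comp measurable_snd)))
  have h1 := lintegral_map (μ := BM.law z) hG ((measurable_freeze s).prodMk (measurable_inc s))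
  rw [map_freeze_inc, lintegral_prod _ hG.aemeasurable,
    lintegral_map hG.lintegral_prod_right' (measurable_freeze s)] at h1
  have hind : ∀ f, A.indicator (fun _ => (1 : ℝ≥0∞)) (freeze s f) =
      A.indicator (fun _ => (1 : ℝ≥0∞)) f := by
    intro f
    by_cases hf : f ∈ A
    · simp [hf, (hAs f).2 hf]
    · simp [hf, mt (hAs f).1 hf]
  have e1 : ∀ f : CPath, (freeze s f).1 s = f.1 s := fun f => freeze_apply le_rfl f
  have e2 : ∀ f : CPath, (inc s f).1 (t - s) = f.1 t - f.1 s := fun f => by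
    rw [inc_apply, add_tsub_cancel_of_le hst]
  simp only [e1, e2, hind] at h1
  have key : ∀ (f : CPath), ∫⁻ h, A.indicator (fun _ => (1 : ℝ≥0∞)) f * g (f.1 s, h.1 (t - s))
      ∂BM.wiener = A.indicator (fun f => ∫⁻ y, g (f.1 s, y) ∂gaussianC (t - s)) f := by
    intro f
    rw [← BM.map_eval_wiener, lintegral_const_mul]
    · by_cases hf : f ∈ A
      · simp only [Set.indicator_of_mem hf, one_mul]
        rw [lintegral_map (f := fun y => g (f.1 s, y))
          (hg.comp (measurable_const.prodMk measurable_id)) (measurable_eval _)]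
      · simp [hf]
    · exact hg.comp (measurable_const.prodMk (measurable_eval _))
  simp only [key] at h1
  rw [lintegral_indicator hA] at h1
  rw [h1, ← lintegral_indicator hA]
  refine lintegral_congr fun f => ?_
  by_cases hf : f ∈ A <;> simp [hf]

/-- On the event that the closed set `C` is hit before time `t`, the increment from the hitting
time to `t` is symmetric given the hitting place: a weak form of the strong Markov property. -/
lemma map_hitVal_symm {C : Set ℂ} (hC : IsClosed C) (t : ℝ≥0) (z : ℂ) {R : ℂ → ℂ}
    (hR : Continuous R) (hRg : ∀ v, (gaussianC v).map R = gaussianC v) :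
    ((BM.law z).restrict (Stay Cᶜ t)ᶜ).map (fun f => (hitVal C t f, R (f.1 t - hitVal C t f))) =
      ((BM.law z).restrict (Stay Cᶜ t)ᶜ).map (fun f => (hitVal C t f, f.1 t - hitVal C t f)) := by
  have hHit := (measurableSet_stay hC.isOpen_compl t).compl
  have hv := measurable_hitVal hC t
  have hd : Measurable fun f : CPath => f.1 t - hitVal C t f := (measurable_eval t).sub hv
  have hm1 : Measurable fun f : CPath => (hitVal C t f, R (f.1 t - hitVal C t f)) :=
    hv.prodMk (hR.measurable.comp hd)
  have hm2 : Measurable fun f : CPath => (hitVal C t f, f.1 t - hitVal C t f) := hv.prodMk hd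
  refine ext_of_forall_lintegral_eq_of_IsFiniteMeasure fun g => ?_
  have hgm : Measurable fun p : ℂ × ℂ => (g p : ℝ≥0∞) :=
    g.continuous.measurable.coe_nnreal_ennreal
  rw [lintegral_map hgm hm1, lintegral_map hgm hm2]
  -- approximation along the grids
  have lim : ∀ S : ℂ → ℂ, Continuous S → Tendsto (fun n => ∫⁻ f in (Stay Cᶜ t)ᶜ,
      (g (f.1 (grid t n (gridIdx C t n f)), S (f.1 t - f.1 (grid t n (gridIdx C t n f)))) : ℝ≥0∞)
        ∂BM.law z) atTop (𝓝 (∫⁻ f in (Stay Cᶜ t)ᶜ,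
          (g (hitVal C t f, S (f.1 t - hitVal C t f)) : ℝ≥0∞) ∂BM.law z)) := by
    intro S hS
    refine tendsto_lintegral_of_dominated_convergence (fun _ => (nndist g 0 : ℝ≥0∞)) ?_ ?_ ?_ ?_
    · intro n
      exact hgm.comp ((measurable_gridVal hC t n).prodMk
        (hS.measurable.comp ((measurable_eval t).sub (measurable_gridVal hC t n))))
    · intro n
      refine Eventually.of_forall fun f => ?_
      have := BoundedContinuousFunction.nndist_coe_le_nndist (f := g) (g := 0)
        (f.1 (grid t n (gridIdx C t n f)), S (f.1 t - f.1 (grid t n (gridIdx C t n f))))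
      rw [BoundedContinuousFunction.coe_zero, Pi.zero_apply, NNReal.nndist_zero_eq_val'] at this
      exact ENNReal.coe_le_coe.2 this
    · simp [ENNReal.mul_eq_top]
    · filter_upwards [ae_restrict_mem hHit] with f hf
      have h1 := tendsto_gridVal hC hf
      have h2 : Tendsto (fun n => S (f.1 t - f.1 (grid t n (gridIdx C t n f)))) atTop
          (𝓝 (S (f.1 t - hitVal C t f))) :=
        (hS.tendsto _).comp (tendsto_const_nhds.sub h1)
      exact (ENNReal.continuous_coe.tendsto _).comp
        ((g.continuous.tendsto _).comp (h1.prodMk_nhds h2))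
  refine tendsto_nhds_unique (lim R hR) ?_
  convert! lim id continuous_id using 2 with n
  have hE : ∀ k, MeasurableSet ((Stay Cᶜ t)ᶜ ∩ gridIdx C t n ⁻¹' {k}) := fun k =>
    hHit.inter (measurable_gridIdx hC t n (measurableSet_singleton k))
  have hU : (Stay Cᶜ t)ᶜ = ⋃ k, ((Stay Cᶜ t)ᶜ ∩ gridIdx C t n ⁻¹' {k}) := by
    rw [← Set.inter_iUnion, ← Set.preimage_iUnion, Set.iUnion_of_singleton, Set.preimage_univ,
      Set.inter_univ]
  have hdisj : Pairwise (Function.onFun Disjoint fun k =>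
      (Stay Cᶜ t)ᶜ ∩ gridIdx C t n ⁻¹' {k}) := by
    intro i j hij
    refine Set.disjoint_left.2 fun f h1 h2 => hij ?_
    have a : gridIdx C t n f = i := h1.2
    have b : gridIdx C t n f = j := h2.2
    omega
  rw [hU, lintegral_iUnion hE hdisj, lintegral_iUnion hE hdisj]
  refine tsum_congr fun k => ?_
  rcases Nat.lt_or_ge (n + 1) k with hk | hk
  · have : (Stay Cᶜ t)ᶜ ∩ gridIdx C t n ⁻¹' {k} = ∅ := by
      refine Set.eq_empty_of_forall_notMem fun f hf => ?_
      have a : gridIdx C t n f = k := hf.2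
      have := gridIdx_le C t n f
      omega
    simp [this]
  have hgt : grid t n k ≤ t := by
    conv_rhs => rw [← grid_last t n]
    exact grid_mono t n hk
  have hAs : ∀ f, freeze (grid t n k) f ∈ (Stay Cᶜ t)ᶜ ∩ gridIdx C t n ⁻¹' {k} ↔
      f ∈ (Stay Cᶜ t)ᶜ ∩ gridIdx C t n ⁻¹' {k} := by
    have char : ∀ f, f ∈ (Stay Cᶜ t)ᶜ ∩ gridIdx C t n ⁻¹' {k} ↔
        f ∉ Stay Cᶜ (grid t n k) ∧ ∀ i < k, f ∈ Stay Cᶜ (grid t n i) := by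
      intro f
      constructor
      · rintro ⟨h1, h2⟩
        have h2 : gridIdx C t n f = k := h2
        subst h2
        exact ⟨notMem_stay_gridIdx n h1, fun i hi => mem_stay_of_lt_gridIdx hi⟩
      · rintro ⟨h1, h2⟩
        have hh : f ∉ Stay Cᶜ t := fun h => h1 (stay_anti _ hgt h)
        refine ⟨hh, ?_⟩
        change gridIdx C t n f = k
        refine le_antisymm (gridIdx_le_of_notMem h1) ?_
        by_contra! hlt
        exact notMem_stay_gridIdx n hh (h2 _ hlt)
    intro f
    rw [char, char, freeze_mem_stay le_rfl]
    refine and_congr_right fun _ => forall₂_congr fun i hi => ?_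
    rw [freeze_mem_stay (grid_mono t n hi.le)]
  have sub : ∀ S : ℂ → ℂ, ∫⁻ f in (Stay Cᶜ t)ᶜ ∩ gridIdx C t n ⁻¹' {k},
      (g (f.1 (grid t n (gridIdx C t n f)), S (f.1 t - f.1 (grid t n (gridIdx C t n f)))) : ℝ≥0∞)
        ∂BM.law z = ∫⁻ f in (Stay Cᶜ t)ᶜ ∩ gridIdx C t n ⁻¹' {k},
      (g (f.1 (grid t n k), S (f.1 t - f.1 (grid t n k))) : ℝ≥0∞) ∂BM.law z := by
    intro S
    refine setLIntegral_congr_fun (hE k) fun f hf => ?_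
    have a : gridIdx C t n f = k := hf.2
    simp only [a]
  rw [sub, sub]
  have i1 := BM.setLIntegral_increment hgt z (hE k) hAs (g := fun p => (g (p.1, R p.2) : ℝ≥0∞))
    (hgm.comp (measurable_fst.prodMk (hR.measurable.comp measurable_snd)))
  have i2 := BM.setLIntegral_increment hgt z (hE k) hAs (g := fun p => (g p : ℝ≥0∞)) hgm
  simp only [id] at *
  rw [i1, i2]
  refine lintegral_congr fun f => ?_
  conv_rhs => rw [← hRg]
  rw [lintegral_map (f := fun y => (g (f.1 (grid t n k), y) : ℝ≥0∞))
    (hgm.comp (measurable_const.prodMk measurable_id)) hR.measurable]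

end PlanarBM

/-- The planar heat kernel as a function of the squared distance. -/
noncomputable def heat (t r : ℝ) : ℝ := (2 * Real.pi * t)⁻¹ * Real.exp (-r / (2 * t))

lemma heat_nonneg {t : ℝ} (ht : 0 ≤ t) (r : ℝ) : 0 ≤ heat t r := by
  unfold heat; positivity

lemma measurable_heat_normSq (t : ℝ) : Measurable fun x : ℂ => ENNReal.ofReal (heat t (Complex.normSq x)) := by
  have : Continuous fun x : ℂ => heat t (Complex.normSq x) := by
    unfold heat
    have := Complex.continuous_normSq
    fun_prop
  exact this.measurable.ennreal_ofReal

lemma gaussianC_map_prodMap (v : ℝ≥0) {S T : ℝ → ℝ} (hS : Measurable S) (hT : Measurable T)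
    (hSg : (ProbabilityTheory.gaussianReal 0 v).map S = ProbabilityTheory.gaussianReal 0 v)
    (hTg : (ProbabilityTheory.gaussianReal 0 v).map T = ProbabilityTheory.gaussianReal 0 v) :
    (gaussianC v).map (fun x => (⟨S x.re, T x.im⟩ : ℂ)) = gaussianC v := by
  have hm : Measurable fun x : ℂ => (⟨S x.re, T x.im⟩ : ℂ) :=
    measurable_equivRealProd_symm.comp ((hS.comp Complex.measurable_re).prodMk
      (hT.comp Complex.measurable_im))
  have h := Measure.map_prod_map (ProbabilityTheory.gaussianReal 0 v)
    (ProbabilityTheory.gaussianReal 0 v) hS hT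
  rw [hSg, hTg] at h
  unfold gaussianC
  rw [Measure.map_map hm measurable_equivRealProd_symm]
  conv_rhs => rw [h, Measure.map_map measurable_equivRealProd_symm (hS.prodMap hT)]
  rfl

lemma gaussianReal_map_neg_zero (v : ℝ≥0) :
    (ProbabilityTheory.gaussianReal 0 v).map (fun x => -x) =
      ProbabilityTheory.gaussianReal 0 v := by
  rw [ProbabilityTheory.gaussianReal_map_neg, neg_zero]

lemma gaussianC_map_conj (v : ℝ≥0) :
    (gaussianC v).map (fun x => (starRingEnd ℂ) x) = gaussianC v :=
  gaussianC_map_prodMap v measurable_id measurable_neg Measure.map_id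
    (gaussianReal_map_neg_zero v)

lemma gaussianC_map_neg_conj (v : ℝ≥0) :
    (gaussianC v).map (fun x => -(starRingEnd ℂ) x) = gaussianC v := by
  have := gaussianC_map_prodMap v measurable_neg measurable_id
    (gaussianReal_map_neg_zero v) Measure.map_id
  convert! this using 2
  ext x
  apply Complex.ext <;> simp

lemma gaussianC_eq_withDensity {v : ℝ≥0} (hv : v ≠ 0) :
    gaussianC v = volume.withDensity fun x => ENNReal.ofReal (heat v (Complex.normSq x)) := by
  ext A hA
  have hm := Complex.volume_preserving_equiv_real_prod.symm
  unfold gaussianC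
  rw [Measure.map_apply measurable_equivRealProd_symm hA,
    ProbabilityTheory.gaussianReal_of_var_ne_zero _ hv,
    prod_withDensity (ProbabilityTheory.measurable_gaussianPDF _ _)
      (ProbabilityTheory.measurable_gaussianPDF _ _), withDensity_apply _ hA,
    withDensity_apply _ (measurable_equivRealProd_symm hA)]
  have h2 := hm.setLIntegral_comp_preimage (s := A) hA (measurable_heat_normSq v)
  refine Eq.trans ?_ h2
  refine setLIntegral_congr_fun (measurable_equivRealProd_symm hA) fun p _ => ?_
  change ENNReal.ofReal _ * ENNReal.ofReal _ = ENNReal.ofReal (heat v (Complex.normSq ⟨p.1, p.2⟩))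
  rw [← ENNReal.ofReal_mul (ProbabilityTheory.gaussianPDFReal_nonneg _ _ _)]
  congr 1
  simp only [ProbabilityTheory.gaussianPDFReal_def, heat, Complex.normSq_mk, sub_zero]
  rw [mul_mul_mul_comm, ← Real.exp_add, ← mul_inv,
    Real.mul_self_sqrt (by positivity)]
  congr 2
  ring

namespace PlanarBM

open CPath

variable {Ω : Type*} [MeasurableSpace Ω] (BM : PlanarBM Ω)

lemma law_eval_preimage {t : ℝ≥0} (ht : t ≠ 0) (z : ℂ) {A : Set ℂ} (hA : MeasurableSet A)
    {ρ : ℂ → ℂ} (hρ : MeasurePreserving ρ) (hinv : Function.Involutive ρ) :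
    BM.law z ((fun f => ρ (f.1 t)) ⁻¹' A) =
      ∫⁻ x in A, ENNReal.ofReal (heat t (Complex.normSq (ρ x - z))) := by
  have h1 : BM.law z ((fun f => ρ (f.1 t)) ⁻¹' A) =
      (BM.law z).map (fun f => f.1 t) (ρ ⁻¹' A) := by
    rw [Measure.map_apply (measurable_eval t) (hρ.measurable hA)]
    rfl
  have hshift : MeasurePreserving (fun x : ℂ => z + x) := measurePreserving_add_left volume z
  rw [h1, map_eval, Measure.map_apply hshift.measurable (hρ.measurable hA),
    gaussianC_eq_withDensity ht,
    withDensity_apply _ (hshift.measurable (hρ.measurable hA))]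
  have hd : Measurable fun x : ℂ => ENNReal.ofReal (heat t (Complex.normSq (x - z))) :=
    (measurable_heat_normSq t).comp (measurable_id.sub_const z)
  have h2 := hshift.setLIntegral_comp_preimage (hρ.measurable hA) hd
  simp only [add_sub_cancel_left] at h2
  rw [h2]
  have h3 := hρ.setLIntegral_comp_preimage (hρ.measurable hA) hd
  rw [← h3, ← Set.preimage_comp, hinv.comp_self, Set.preimage_id]

end PlanarBM

/-- `ρ` is the reflection across the boundary of the closed half-plane `C`. -/
structure IsReflection (C : Set ℂ) (ρ : ℂ → ℂ) : Prop where
  isClosed : IsClosed C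
  exists_linear : ∃ (R : ℂ → ℂ) (b : ℂ), Continuous R ∧ (∀ v, (gaussianC v).map R = gaussianC v) ∧
    (∀ x y, R (x + y) = R x + R y) ∧ ∀ x, ρ x = R x + b
  fix : ∀ x ∈ frontier C, ρ x = x
  measurePreserving : MeasurePreserving ρ
  involutive : Function.Involutive ρ

lemma measurePreserving_conj : MeasurePreserving (fun x : ℂ => (starRingEnd ℂ) x) :=
  Complex.conjLIE.measurePreserving

/-- Reflection across a horizontal line. -/
noncomputable def reflIm (h : ℝ) (x : ℂ) : ℂ := (starRingEnd ℂ) x + 2 * h * Complex.I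

/-- Reflection across a vertical line. -/
noncomputable def reflRe (h : ℝ) (x : ℂ) : ℂ := -(starRingEnd ℂ) x + 2 * h

lemma isReflection_reflIm (h : ℝ) {C : Set ℂ} (hC : IsClosed C)
    (hf : frontier C ⊆ {x | x.im = h}) : IsReflection C (reflIm h) where
  isClosed := hC
  exists_linear := ⟨fun x => (starRingEnd ℂ) x, 2 * h * Complex.I, Complex.continuous_conj,
    gaussianC_map_conj, fun x y => map_add _ x y, fun _ => rfl⟩
  fix x hx := by
    have : x.im = h := hf hx
    apply Complex.ext <;> simp [reflIm, this]
    ring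
  measurePreserving := (measurePreserving_add_right volume _).comp measurePreserving_conj
  involutive x := by
    apply Complex.ext <;> simp [reflIm]

lemma isReflection_reflRe (h : ℝ) {C : Set ℂ} (hC : IsClosed C)
    (hf : frontier C ⊆ {x | x.re = h}) : IsReflection C (reflRe h) where
  isClosed := hC
  exists_linear := ⟨fun x => -(starRingEnd ℂ) x, 2 * h, Complex.continuous_conj.neg,
    gaussianC_map_neg_conj, fun x y => by simp [add_comm], fun _ => rfl⟩
  fix x hx := by
    have : x.re = h := hf hx
    apply Complex.ext <;> simp [reflRe, this]
    ring
  measurePreserving := (measurePreserving_add_right volume _).comp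
    ((Measure.measurePreserving_neg volume).comp measurePreserving_conj)
  involutive x := by
    apply Complex.ext <;> simp [reflRe]

namespace PlanarBM

open CPath

variable {Ω : Type*} [MeasurableSpace Ω] (BM : PlanarBM Ω)

/-- The reflection principle. -/
lemma law_hit_le {C : Set ℂ} {ρ : ℂ → ℂ} (hρ : IsReflection C ρ) {z : ℂ} (hz : z ∉ C)
    (t : ℝ≥0) {A : Set ℂ} (hA : MeasurableSet A) :
    BM.law z ((fun f => f.1 t) ⁻¹' A ∩ (Stay Cᶜ t)ᶜ) ≤
      BM.law z ((fun f => ρ (f.1 t)) ⁻¹' A) := by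
  obtain ⟨R, b, hR, hRg, hadd, hb⟩ := hρ.exists_linear
  have hC := hρ.isClosed
  have hHit := (measurableSet_stay hC.isOpen_compl t).compl
  have hv := measurable_hitVal hC t
  have hd : Measurable fun f : CPath => f.1 t - hitVal C t f := (measurable_eval t).sub hv
  have hm1 : Measurable fun f : CPath => (hitVal C t f, R (f.1 t - hitVal C t f)) :=
    hv.prodMk (hR.measurable.comp hd)
  have hm2 : Measurable fun f : CPath => (hitVal C t f, f.1 t - hitVal C t f) := hv.prodMk hd
  have hS : MeasurableSet {p : ℂ × ℂ | p.1 + p.2 ∈ A} :=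
    (measurable_fst.add measurable_snd) hA
  have h := congrArg (fun m => m {p : ℂ × ℂ | p.1 + p.2 ∈ A}) (BM.map_hitVal_symm hC t z hR hRg)
  simp only [Measure.map_apply hm1 hS, Measure.map_apply hm2 hS, Measure.restrict_apply (hm1 hS),
    Measure.restrict_apply (hm2 hS)] at h
  have e2 : (fun f : CPath => (hitVal C t f, f.1 t - hitVal C t f)) ⁻¹'
      {p : ℂ × ℂ | p.1 + p.2 ∈ A} = (fun f => f.1 t) ⁻¹' A := by
    ext f
    simp
  rw [e2] at h
  rw [← h]
  refine measure_mono_ae ?_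
  filter_upwards [BM.law_start z] with f hf0 hf
  obtain ⟨hfA, hfH⟩ := hf
  have hfr := apply_hitT_mem_frontier hC hfH (by rwa [hf0])
  have hval : hitVal C t f = f.1 (hitT C f) := Set.indicator_of_mem hfH _
  have hfA : hitVal C t f + R (f.1 t - hitVal C t f) ∈ A := hfA
  have hfix := hρ.fix _ hfr
  rw [← hval, hb] at hfix
  change ρ (f.1 t) ∈ A
  have : ρ (f.1 t) = hitVal C t f + R (f.1 t - hitVal C t f) := by
    rw [hb, ← hfix]
    have := hadd (hitVal C t f) (f.1 t - hitVal C t f)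
    rw [add_sub_cancel] at this
    rw [hfix, this, ← hfix]
    rw [hfix]
    linear_combination hfix
  rwa [this]

/-- Killed kernels of intersections of half-planes are bounded below by the alternating sum of
the heat kernel over the first reflections. -/
lemma le_killed_of_reflections {ι : Type*} [Fintype ι] {C : ι → Set ℂ} {ρ : ι → ℂ → ℂ}
    (hρ : ∀ i, IsReflection (C i) (ρ i)) {z : ℂ} (hz : ∀ i, z ∉ C i) {t : ℝ≥0} (ht : t ≠ 0)
    {V : Set ℂ} (hV : MeasurableSet V) {c : ℝ} (hc : 0 ≤ c)
    (hcV : ∀ x ∈ V, c + ∑ i, heat t (Complex.normSq (ρ i x - z)) ≤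
      heat t (Complex.normSq (x - z))) :
    ENNReal.ofReal c • volume.restrict V ≤ BM.killed (⋂ i, (C i)ᶜ) t z := by
  refine Measure.le_iff.2 fun A hA => ?_
  have hAV : MeasurableSet (A ∩ V) := hA.inter hV
  refine le_trans ?_ (measure_mono (Set.inter_subset_left : A ∩ V ⊆ A))
  rw [Measure.smul_apply, Measure.restrict_apply hA, smul_eq_mul, BM.killed_apply _ t z hAV]
  have hst : (0 : ℝ) ≤ t := t.2
  -- decomposition of the unkilled law
  have up : BM.law z ((fun f => f.1 t) ⁻¹' (A ∩ V)) ≤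
      BM.law z ((fun f => f.1 t) ⁻¹' (A ∩ V) ∩ Stay (⋂ i, (C i)ᶜ) t) +
        ∑ i, BM.law z ((fun f => ρ i (f.1 t)) ⁻¹' (A ∩ V)) := by
    have cover : (fun f : CPath => f.1 t) ⁻¹' (A ∩ V) ⊆
        ((fun f => f.1 t) ⁻¹' (A ∩ V) ∩ Stay (⋂ i, (C i)ᶜ) t) ∪
          ⋃ i, ((fun f => f.1 t) ⁻¹' (A ∩ V) ∩ (Stay (C i)ᶜ t)ᶜ) := by
      intro f hf
      by_cases hs : f ∈ Stay (⋂ i, (C i)ᶜ) t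
      · exact Or.inl ⟨hf, hs⟩
      · right
        have : ∃ i, f ∉ Stay (C i)ᶜ t := by
          by_contra! hall
          exact hs fun s hs => Set.mem_iInter.2 fun i => hall i s hs
        obtain ⟨i, hi⟩ := this
        exact Set.mem_iUnion.2 ⟨i, hf, hi⟩
    refine (measure_mono cover).trans ((measure_union_le _ _).trans ?_)
    gcongr
    refine (measure_iUnion_le _).trans ?_
    rw [tsum_fintype]
    exact Finset.sum_le_sum fun i _ => BM.law_hit_le (hρ i) (hz i) t hAV
  have hfin : ∑ i, BM.law z ((fun f => ρ i (f.1 t)) ⁻¹' (A ∩ V)) ≠ ∞ :=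
    ENNReal.sum_ne_top.2 fun i _ => measure_ne_top _ _
  have low : ENNReal.ofReal c * volume (V ∩ A) +
      ∑ i, BM.law z ((fun f => ρ i (f.1 t)) ⁻¹' (A ∩ V)) ≤
        BM.law z ((fun f => f.1 t) ⁻¹' (A ∩ V)) := by
    have h0 := BM.law_eval_preimage ht z hAV (MeasurePreserving.id volume) (fun _ => rfl)
    simp only [id] at h0
    rw [h0]
    have hmeas : ∀ i, Measurable fun x : ℂ =>
        ENNReal.ofReal (heat t (Complex.normSq (ρ i x - z))) := fun i =>
      (measurable_heat_normSq t).comp ((hρ i).measurePreserving.measurable.sub_const z)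
    simp only [BM.law_eval_preimage ht z hAV (hρ _).measurePreserving (hρ _).involutive]
    rw [← lintegral_finsetSum _ (fun i _ => hmeas i), Set.inter_comm V A, ← setLIntegral_const,
      ← lintegral_add_left measurable_const]
    refine setLIntegral_mono' hAV fun x hx => ?_
    rw [← ENNReal.ofReal_sum_of_nonneg (fun i _ => heat_nonneg hst _),
      ← ENNReal.ofReal_add hc (Finset.sum_nonneg fun i _ => heat_nonneg hst _)]
    exact ENNReal.ofReal_le_ofReal (hcV x hx.2)
  rw [Set.inter_comm A V]
  have := low.trans up
  rw [Set.inter_comm A V] at this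
  exact (ENNReal.add_le_add_iff_right (by rwa [Set.inter_comm] at hfin)).1 this

end PlanarBM

lemma heat_anti {t : ℝ} (ht : 0 ≤ t) : Antitone (heat t) := fun r r' h => by
  unfold heat
  gcongr

lemma frontier_re_ge (h : ℝ) : frontier {x : ℂ | h ≤ x.re} ⊆ {x | x.re = h} := by
  rw [Complex.frontier_setOfPred_le_re]

lemma frontier_re_le (h : ℝ) : frontier {x : ℂ | x.re ≤ h} ⊆ {x | x.re = h} := by
  rw [Complex.frontier_setOfPred_re_le]

lemma frontier_im_ge (h : ℝ) : frontier {x : ℂ | h ≤ x.im} ⊆ {x | x.im = h} := by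
  rw [Complex.frontier_setOfPred_le_im]

lemma frontier_im_le (h : ℝ) : frontier {x : ℂ | x.im ≤ h} ⊆ {x | x.im = h} := by
  rw [Complex.frontier_setOfPred_im_le]

namespace PlanarBM

open CPath

variable {Ω : Type*} [MeasurableSpace Ω] (BM : PlanarBM Ω)

lemma exists_le_killed_ball {D : Set ℂ} {p : ℂ} {a : ℝ} (ha : 0 < a)
    (hD : Metric.ball p (2 * a) ⊆ D) :
    ∃ (t : ℝ≥0) (c : ℝ≥0∞), c ≠ 0 ∧ ∀ z ∈ Metric.ball p (a / 4),
      c • volume.restrict (Metric.ball p (a / 4)) ≤ BM.killed D t z := by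
  set δ : ℝ≥0 := ⟨a ^ 2 / 4, by positivity⟩ with hδ
  have hδ0 : δ ≠ 0 := by
    intro h
    have := congrArg NNReal.toReal h
    have h2 : a ^ 2 / 4 = 0 := this
    have : 0 < a ^ 2 / 4 := by positivity
    linarith
  have hδc : (δ : ℝ) = a ^ 2 / 4 := rfl
  set c : ℝ := heat δ (a ^ 2 / 4) - 4 * heat δ (9 / 4 * a ^ 2) with hc
  have hcpos : 0 < c := by
    have e1 : heat δ (a ^ 2 / 4) = (2 * Real.pi * δ)⁻¹ * Real.exp (-1 / 2) := by
      unfold heat; congr 2; rw [hδc]; field_simp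
    have e2 : heat δ (9 / 4 * a ^ 2) = (2 * Real.pi * δ)⁻¹ * Real.exp (-9 / 2) := by
      unfold heat; congr 2; rw [hδc]; field_simp
    have e3 : Real.exp (-1 / 2) = Real.exp 4 * Real.exp (-9 / 2) := by
      rw [← Real.exp_add]; norm_num
    rw [hc, e1, e2, e3]
    have h4 : (5 : ℝ) ≤ Real.exp 4 := by
      have := Real.add_one_le_exp (4 : ℝ); linarith
    have hp : 0 < (2 * Real.pi * δ)⁻¹ * Real.exp (-9 / 2) := by rw [hδc]; positivity
    nlinarith
  refine ⟨δ, ENNReal.ofReal c, by simpa using hcpos, fun z hz => ?_⟩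
  set C : Fin 4 → Set ℂ := ![{x | p.re + a ≤ x.re}, {x | x.re ≤ p.re - a},
    {x | p.im + a ≤ x.im}, {x | x.im ≤ p.im - a}] with hC
  set ρ : Fin 4 → ℂ → ℂ := ![reflRe (p.re + a), reflRe (p.re - a), reflIm (p.im + a),
    reflIm (p.im - a)] with hρ
  have hbox : ∀ x ∈ Metric.ball p (a / 4), |x.re - p.re| < a / 4 ∧ |x.im - p.im| < a / 4 := by
    intro x hx
    rw [Metric.mem_ball, dist_eq_norm] at hx
    exact ⟨(Complex.abs_re_le_norm (x - p)).trans_lt hx,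
      (Complex.abs_im_le_norm (x - p)).trans_lt hx⟩
  have hrefl : ∀ i, IsReflection (C i) (ρ i) := by
    intro i
    fin_cases i
    · exact isReflection_reflRe _ (isClosed_le continuous_const Complex.continuous_re)
        (frontier_re_ge _)
    · exact isReflection_reflRe _ (isClosed_le Complex.continuous_re continuous_const)
        (frontier_re_le _)
    · exact isReflection_reflIm _ (isClosed_le continuous_const Complex.continuous_im)
        (frontier_im_ge _)
    · exact isReflection_reflIm _ (isClosed_le Complex.continuous_im continuous_const)
        (frontier_im_le _)
  obtain ⟨z1, z2⟩ := hbox z hz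
  rw [abs_lt] at z1 z2
  have hzC : ∀ i, z ∉ C i := by
    intro i
    fin_cases i <;> simp [C] <;> linarith
  have hsub : (⋂ i, (C i)ᶜ) ⊆ D := by
    intro x hx
    apply hD
    have h0 := Set.mem_iInter.1 hx
    have i0 : ¬ (p.re + a ≤ x.re) := h0 0
    have i1 : ¬ (x.re ≤ p.re - a) := h0 1
    have i2 : ¬ (p.im + a ≤ x.im) := h0 2
    have i3 : ¬ (x.im ≤ p.im - a) := h0 3
    rw [Metric.mem_ball, dist_eq_norm]
    refine (Complex.norm_le_abs_re_add_abs_im _).trans_lt ?_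
    have a1 : |(x - p).re| < a := by rw [Complex.sub_re, abs_lt]; constructor <;> linarith
    have a2 : |(x - p).im| < a := by rw [Complex.sub_im, abs_lt]; constructor <;> linarith
    linarith
  refine le_trans (BM.le_killed_of_reflections hrefl hzC hδ0 Metric.isOpen_ball.measurableSet
    hcpos.le fun x hx => ?_) (BM.killed_mono hsub δ z)
  obtain ⟨x1, x2⟩ := hbox x hx
  rw [abs_lt] at x1 x2
  have hδn : (0 : ℝ) ≤ δ := δ.2
  have hmain : heat δ (a ^ 2 / 4) ≤ heat δ (Complex.normSq (x - z)) := by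
    apply heat_anti hδn
    rw [Complex.normSq_apply, Complex.sub_re, Complex.sub_im]
    rw [Metric.mem_ball] at hx hz
    have := (dist_triangle_right x z p).trans_lt (add_lt_add hx hz)
    rw [dist_eq_norm] at this
    have h2 : Complex.normSq (x - z) < (a / 4 + a / 4) ^ 2 := by
      rw [Complex.normSq_eq_norm_sq]
      exact pow_lt_pow_left₀ this (norm_nonneg _) two_ne_zero
    rw [Complex.normSq_apply, Complex.sub_re, Complex.sub_im] at h2
    nlinarith
  have hr : ∀ i, heat δ (Complex.normSq (ρ i x - z)) ≤ heat δ (9 / 4 * a ^ 2) := by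
    intro i
    apply heat_anti hδn
    rw [Complex.normSq_apply]
    fin_cases i <;> simp [ρ, reflRe, reflIm]
    · nlinarith [mul_self_nonneg (x.im - z.im), mul_self_nonneg (-x.re + 2 * (p.re + a) - z.re)]
    · nlinarith [mul_self_nonneg (x.im - z.im), mul_self_nonneg (-x.re + 2 * (p.re - a) - z.re)]
    · nlinarith [mul_self_nonneg (x.re - z.re), mul_self_nonneg (-x.im + 2 * (p.im + a) - z.im)]
    · nlinarith [mul_self_nonneg (x.re - z.re), mul_self_nonneg (-x.im + 2 * (p.im - a) - z.im)]
  have hsum : ∑ i, heat δ (Complex.normSq (ρ i x - z)) ≤ 4 * heat δ (9 / 4 * a ^ 2) := by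
    refine (Finset.sum_le_sum fun i _ => hr i).trans ?_
    simp
  linarith

/-- Brownian motion killed outside a domain reaches any region with a density bounded below. -/
lemma exists_le_killed {D : Set ℂ} (hD : IsOpen D) (hDc : IsPreconnected D) {p q : ℂ}
    (hp : p ∈ D) (hq : q ∈ D) :
    ∃ (t : ℝ≥0) (c : ℝ≥0∞) (r : ℝ), c ≠ 0 ∧ 0 < r ∧ ∀ z ∈ Metric.ball p r,
      c • volume.restrict (Metric.ball q r) ≤ BM.killed D t z := by
  refine hDc.induction₂' (fun p q => ∃ (t : ℝ≥0) (c : ℝ≥0∞) (r : ℝ), c ≠ 0 ∧ 0 < r ∧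
    ∀ z ∈ Metric.ball p r, c • volume.restrict (Metric.ball q r) ≤ BM.killed D t z) ?_ ?_ hp hq
  · intro x hx
    obtain ⟨ε, hε, hb⟩ := Metric.isOpen_iff.1 hD x hx
    obtain ⟨t, c, hc, h⟩ := BM.exists_le_killed_ball (D := D) (p := x) (a := ε / 2)
      (by positivity) (by rwa [mul_div_cancel₀ _ two_ne_zero])
    have hev : ∀ᶠ y in 𝓝[D] x, y ∈ Metric.ball x (ε / 16) :=
      mem_nhdsWithin_of_mem_nhds (Metric.ball_mem_nhds _ (by positivity))
    filter_upwards [hev] with y hy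
    have s1 : Metric.ball x (ε / 16) ⊆ Metric.ball x (ε / 2 / 4) :=
      Metric.ball_subset_ball (by linarith)
    have s2 : Metric.ball y (ε / 16) ⊆ Metric.ball x (ε / 2 / 4) := by
      refine Metric.ball_subset_ball' ?_
      rw [Metric.mem_ball] at hy
      linarith
    refine ⟨⟨t, c, ε / 16, hc, by positivity, fun z hz => le_trans ?_ (h z (s1 hz))⟩,
      ⟨t, c, ε / 16, hc, by positivity, fun z hz => le_trans ?_ (h z (s2 hz))⟩⟩
    · gcongr
    · gcongr
  · rintro x y w - - - ⟨t, c, r, hc, hr, h⟩ ⟨t', c', r', hc', hr', h'⟩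
    refine ⟨t + t', c * volume (Metric.ball y (min r r')) * c', min r r', ?_, by positivity,
      fun z hz => ?_⟩
    · refine mul_ne_zero (mul_ne_zero hc ?_) hc'
      exact (Metric.measure_ball_pos volume y (lt_min hr hr')).ne'
    · refine BM.le_killed_add hD Metric.isOpen_ball.measurableSet
        (Metric.ball_subset_ball (min_le_left r r'))
        (h z (Metric.ball_subset_ball (min_le_left _ _) hz)) fun v hv => ?_
      refine le_trans ?_ (h' v (Metric.ball_subset_ball (min_le_right _ _) hv))
      gcongr
      exact min_le_right _ _

/-- Lower bound for the kernel of Brownian motion killed outside the half-plane `{Im > H}`. -/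
lemma le_killed_halfPlane {H y : ℝ} (hH : 0 ≤ H) (hy : 2 * H + 6 ≤ y) {t : ℝ≥0}
    (ht : y ^ 2 ≤ t) (ht' : t ≤ 2 * y ^ 2) :
    ENNReal.ofReal (Real.exp (-1) / (16 * Real.pi) / y ^ 3) •
        volume.restrict (Metric.ball (((H + 2 : ℝ) : ℂ) * Complex.I) 1) ≤
      BM.killed {x | H < x.im} t ((y : ℂ) * Complex.I) := by
  have hy0 : 0 < y := by linarith
  have ht0 : (0 : ℝ) < t := by nlinarith
  have htne : t ≠ 0 := fun h => by simp [h] at ht0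
  have h := BM.le_killed_of_reflections (ι := Unit) (C := fun _ => {x : ℂ | x.im ≤ H})
    (ρ := fun _ => reflIm H) (fun _ => isReflection_reflIm H
      (isClosed_le Complex.continuous_im continuous_const) (frontier_im_le H))
    (z := (y : ℂ) * Complex.I) (fun _ => by simp; linarith) htne
    (V := Metric.ball (((H + 2 : ℝ) : ℂ) * Complex.I) 1) Metric.isOpen_ball.measurableSet
    (c := Real.exp (-1) / (16 * Real.pi) / y ^ 3) (by positivity) ?_
  · convert! h using 2
    ext x; simp
  intro x hx
  simp only [Finset.univ_unique, Finset.sum_singleton]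
  rw [Metric.mem_ball, dist_eq_norm] at hx
  have x1 := (Complex.abs_re_le_norm _).trans_lt hx
  have x2 := (Complex.abs_im_le_norm _).trans_lt hx
  simp [abs_lt] at x1 x2
  have e1 : Complex.normSq (reflIm H x - (y : ℂ) * Complex.I) =
      Complex.normSq (x - (y : ℂ) * Complex.I) + 4 * (x.im - H) * (y - H) := by
    simp [Complex.normSq_apply, reflIm]; ring
  have e2 : Complex.normSq (x - (y : ℂ) * Complex.I) ≤ 2 * y ^ 2 := by
    simp [Complex.normSq_apply]; nlinarith
  have e3 : 2 * y ≤ 4 * (x.im - H) * (y - H) := by nlinarith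
  have b1 : heat t (Complex.normSq (reflIm H x - (y : ℂ) * Complex.I)) ≤
      heat t (Complex.normSq (x - (y : ℂ) * Complex.I)) * Real.exp (-(y / t)) := by
    unfold heat
    rw [mul_assoc (_⁻¹) (Real.exp _) (Real.exp _), ← Real.exp_add]
    gcongr
    rw [e1]
    have : y / t = 2 * y / (2 * t) := by field_simp
    rw [this, ← neg_div, ← add_div]
    gcongr
    linarith
  have b2 : Real.exp (-(y / t)) ≤ 1 - 1 / (4 * y) := by
    have hu : 1 / (2 * y) ≤ y / t := by
      rw [div_le_div_iff₀ (by positivity) ht0]; nlinarith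
    have h1 : Real.exp (-(y / t)) ≤ Real.exp (-(1 / (2 * y))) := by gcongr
    have hv0 : 0 ≤ 1 / (2 * y) := by positivity
    have hv1 : 1 / (2 * y) ≤ 1 := by rw [div_le_one (by positivity)]; linarith
    have h2 : Real.exp (-(1 / (2 * y))) ≤ 1 - 1 / (2 * y) / 2 := by
      have := Real.add_one_le_exp (1 / (2 * y))
      rw [Real.exp_neg]
      have hp : (0 : ℝ) < 1 + 1 / (2 * y) := by positivity
      calc (Real.exp (1 / (2 * y)))⁻¹ ≤ (1 + 1 / (2 * y))⁻¹ := by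
            gcongr; linarith
        _ ≤ _ := by
            rw [inv_le_iff_one_le_mul₀ hp]
            nlinarith
    refine h1.trans (h2.trans (le_of_eq ?_))
    field_simp; ring
  have b3 : (4 * Real.pi * y ^ 2)⁻¹ * Real.exp (-1) ≤
      heat t (Complex.normSq (x - (y : ℂ) * Complex.I)) := by
    unfold heat
    have : -1 ≤ -Complex.normSq (x - (y : ℂ) * Complex.I) / (2 * t) := by
      rw [neg_div, neg_le_neg_iff, div_le_one (by positivity)]
      linarith
    gcongr ?_⁻¹ * Real.exp ?_
    nlinarith [Real.pi_pos]
  have hg : 0 ≤ heat t (Complex.normSq (x - (y : ℂ) * Complex.I)) := heat_nonneg ht0.le _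
  have b4 : heat t (Complex.normSq (x - (y : ℂ) * Complex.I)) * Real.exp (-(y / t)) ≤
      heat t (Complex.normSq (x - (y : ℂ) * Complex.I)) * (1 - 1 / (4 * y)) := by gcongr
  have b5 : Real.exp (-1) / (16 * Real.pi) / y ^ 3 =
      (4 * Real.pi * y ^ 2)⁻¹ * Real.exp (-1) * (1 / (4 * y)) := by
    field_simp; norm_num
  have b6 : (4 * Real.pi * y ^ 2)⁻¹ * Real.exp (-1) * (1 / (4 * y)) ≤
      heat t (Complex.normSq (x - (y : ℂ) * Complex.I)) * (1 / (4 * y)) := by gcongr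
  rw [b5]
  linarith

end PlanarBM

lemma gaussianC_map_im (v : ℝ≥0) :
    (gaussianC v).map Complex.im = ProbabilityTheory.gaussianReal 0 v := by
  rw [gaussianC, Measure.map_map Complex.measurable_im measurable_equivRealProd_symm]
  exact (Measure.snd_prod (μ := ProbabilityTheory.gaussianReal 0 v))

lemma integrable_im_gaussianC (v : ℝ≥0) : Integrable Complex.im (gaussianC v) := by
  have h : Integrable id ((gaussianC v).map Complex.im) := by
    rw [gaussianC_map_im]
    exact (ProbabilityTheory.memLp_id_gaussianReal 1).integrable le_rfl
  exact (integrable_map_measure aestronglyMeasurable_id Complex.measurable_im.aemeasurable).1 h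

lemma integral_im_gaussianC (v : ℝ≥0) : ∫ x, x.im ∂gaussianC v = 0 := by
  have h := integral_map (μ := gaussianC v) Complex.measurable_im.aemeasurable
    (f := fun x : ℝ => x) aestronglyMeasurable_id
  rw [gaussianC_map_im, ProbabilityTheory.integral_id_gaussianReal] at h
  exact h.symm

namespace CPath

lemma apply_hitT_mem_or {G : Set ℂ} (hGo : IsOpen (UH \ G)) {t : ℝ≥0} {f : CPath}
    (h : f ∉ Stay (UH \ G) t) (h0 : f.1 0 ∈ UH \ G) :
    f.1 (hitT (UH \ G)ᶜ f) ∈ G ∨ (f.1 (hitT (UH \ G)ᶜ f) ∉ UH ∧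
      (f.1 (hitT (UH \ G)ᶜ f)).im = 0) := by
  have h' : f ∉ Stay (UH \ G)ᶜᶜ t := by rwa [compl_compl]
  have h1 := apply_hitT hGo.isClosed_compl h'
  have h2 := apply_hitT_mem_frontier hGo.isClosed_compl h' (by simpa using h0)
  rw [frontier_compl] at h2
  have h3 : f.1 (hitT (UH \ G)ᶜ f) ∈ {x : ℂ | 0 ≤ x.im} :=
    closure_minimal (fun x (hx : x ∈ UH \ G) => le_of_lt hx.1)
      (isClosed_le continuous_const Complex.continuous_im) (frontier_subset_closure h2)
  by_cases hG : f.1 (hitT (UH \ G)ᶜ f) ∈ G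
  · exact Or.inl hG
  · have h4 : f.1 (hitT (UH \ G)ᶜ f) ∉ UH := fun hu => h1 ⟨hu, hG⟩
    exact Or.inr ⟨h4, le_antisymm (not_lt.1 h4) h3⟩

lemma hitVal_of_notMem {C : Set ℂ} {t : ℝ≥0} {f : CPath} (h : f ∉ Stay Cᶜ t) :
    hitVal C t f = f.1 (hitT C f) :=
  Set.indicator_of_mem (show f ∈ (Stay Cᶜ t)ᶜ from h) _

lemma hitVal_of_mem {C : Set ℂ} {t : ℝ≥0} {f : CPath} (h : f ∈ Stay Cᶜ t) :
    hitVal C t f = 0 :=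
  Set.indicator_of_notMem (show f ∉ (Stay Cᶜ t)ᶜ from fun h' => h' h) _

lemma abs_im_hitVal_le {G : Set ℂ} (hG : G ⊆ UH) (hGo : IsOpen (UH \ G)) {H : ℝ} (hH : 0 ≤ H)
    (hGH : ∀ x ∈ G, x.im ≤ H) (t : ℝ≥0) {f : CPath} (h0 : f.1 0 ∈ UH \ G) :
    |(hitVal (UH \ G)ᶜ t f).im| ≤ H := by
  by_cases h : f ∈ Stay (UH \ G)ᶜᶜ t
  · simpa [hitVal_of_mem h] using hH
  · rw [hitVal_of_notMem h]
    rw [compl_compl] at h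
    rcases apply_hitT_mem_or hGo h h0 with h1 | h1
    · rw [abs_of_pos (hG h1)]; exact hGH _ h1
    · rw [h1.2]; simpa using hH

lemma isOpen_UH : IsOpen UH := isOpen_lt continuous_const Complex.continuous_im

lemma tendsto_im_hitVal {G : Set ℂ} (hG : G ⊆ UH) (hGo : IsOpen (UH \ G)) {f : CPath}
    (h0 : f.1 0 ∈ UH \ G) {p : ℝ → ℂ} (hp : ∀ t : ℝ≥0, p t = f.1 t) :
    Tendsto (fun n : ℕ => (hitVal (UH \ G)ᶜ n f).im) atTop (𝓝 (imAtHit p G)) := by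
  classical
  have hp' : ∀ t : ℝ, 0 ≤ t → p t = f.1 t.toNNReal := fun t ht => by
    rw [← hp, Real.coe_toNNReal t ht]
  by_cases hall : ∀ n : ℕ, f ∈ Stay (UH \ G) n
  · have hlim : imAtHit p G = 0 := by
      rw [imAtHit, dif_neg]
      rintro ⟨t, ht, h1, -⟩
      have hemp : {t : ℝ | 0 ≤ t ∧ p t ∈ G} = ∅ := by
        ext s
        simp only [Set.mem_ofPred_eq, Set.mem_empty_iff_false, iff_false, not_and]
        intro hs hsG
        obtain ⟨n, hn⟩ := exists_nat_ge s.toNNReal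
        rw [hp' s hs] at hsG
        exact (hall n _ hn).2 hsG
      rw [hitTime, hemp] at h1
      simp at h1
    rw [hlim]
    refine tendsto_const_nhds.congr fun n => ?_
    rw [hitVal_of_mem (by rw [compl_compl]; exact hall n), Complex.zero_im]
  · push Not at hall
    obtain ⟨n₀, hn₀⟩ := hall
    set T := hitT (UH \ G)ᶜ f with hT
    have hval : (f.1 T).im = imAtHit p G := by
      have hbefore : ∀ s : ℝ≥0, f.1 s ∉ UH \ G → T ≤ s := fun s hs => hitT_le hs
      have hlow : ENNReal.ofReal T ≤ hitTime p G := by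
        refine le_sInf ?_
        rintro _ ⟨s, ⟨hs0, hsG⟩, rfl⟩
        rw [hp' s hs0] at hsG
        apply ENNReal.ofReal_le_ofReal
        rw [← Real.coe_toNNReal s hs0]
        exact_mod_cast hbefore _ fun h => h.2 hsG
      rcases apply_hitT_mem_or hGo hn₀ h0 with h1 | ⟨h1, h2⟩
      · have heq : ENNReal.ofReal T = hitTime p G :=
          le_antisymm hlow (sInf_le ⟨T, ⟨T.2, by rw [hp]; exact h1⟩, rfl⟩)
        have hexit : hitTime p G < exitTime p UH := by
          rw [← heq]
          have hnhds : f.1 ⁻¹' UH ∈ 𝓝 T := f.2.continuousAt.preimage_mem_nhds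
            (isOpen_UH.mem_nhds (hG h1))
          obtain ⟨ε, hε, hb⟩ := Metric.mem_nhds_iff.1 hnhds
          refine lt_of_lt_of_le (b := ENNReal.ofReal (T + ε))
            ((ENNReal.ofReal_lt_ofReal_iff (add_pos_of_nonneg_of_pos T.2 hε)).2
              (lt_add_of_pos_right _ hε)) ?_
          refine le_sInf ?_
          rintro _ ⟨s, ⟨hs0, hsU⟩, rfl⟩
          apply ENNReal.ofReal_le_ofReal
          rw [hp' s hs0] at hsU
          have hTs : T ≤ s.toNNReal := hbefore _ fun h => hsU h.1
          have hTs' : (T : ℝ) ≤ s := by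
            rw [← Real.coe_toNNReal s hs0]; exact_mod_cast hTs
          by_contra! hlt
          refine hsU (hb ?_)
          rw [Metric.mem_ball, NNReal.dist_eq, Real.coe_toNNReal s hs0, abs_of_nonneg (by linarith)]
          linarith
        have hex : ∃ t : ℝ, 0 ≤ t ∧ ENNReal.ofReal t = hitTime p G ∧
            hitTime p G < exitTime p UH := ⟨T, T.2, heq, hexit⟩
        rw [imAtHit, dif_pos hex]
        obtain ⟨c1, c2, -⟩ := hex.choose_spec
        have : hex.choose = (T : ℝ) := by
          exact (ENNReal.ofReal_eq_ofReal_iff c1 T.2).1 (c2.trans heq.symm)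
        rw [this, hp]
      · rw [h2, imAtHit, dif_neg]
        rintro ⟨-, -, -, hlt⟩
        have : exitTime p UH ≤ ENNReal.ofReal T :=
          sInf_le ⟨T, ⟨T.2, by rw [hp]; exact h1⟩, rfl⟩
        exact absurd (hlt.trans_le (this.trans hlow)) (lt_irrefl _)
    rw [← hval]
    refine tendsto_const_nhds.congr' ?_
    filter_upwards [eventually_ge_atTop n₀] with n hn
    rw [hitVal_of_notMem]
    rw [compl_compl]
    exact fun h => hn₀ (stay_anti _ (by exact_mod_cast hn) h)

end CPath

namespace PlanarBM

open CPath

variable {Ω : Type*} [MeasurableSpace Ω] (BM : PlanarBM Ω)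

lemma integrable_im (z : ℂ) (t : ℝ≥0) : Integrable (fun f : CPath => (f.1 t).im) (BM.law z) := by
  have h : Integrable Complex.im ((BM.law z).map fun f => f.1 t) := by
    rw [map_eval, integrable_map_measure Complex.measurable_im.aestronglyMeasurable
      (measurable_const_add z).aemeasurable]
    exact (integrable_const z.im).add (integrable_im_gaussianC t)
  exact (integrable_map_measure Complex.measurable_im.aestronglyMeasurable
    (measurable_eval t).aemeasurable).1 h

lemma integral_im (z : ℂ) (t : ℝ≥0) : ∫ f, (f.1 t).im ∂BM.law z = z.im := by
  have h := integral_map (μ := BM.law z) (measurable_eval t).aemeasurable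
    (f := Complex.im) Complex.measurable_im.aestronglyMeasurable
  rw [← h, map_eval, integral_map (measurable_const_add z).aemeasurable
    Complex.measurable_im.aestronglyMeasurable]
  simp only [Complex.add_im]
  rw [integral_add (integrable_const _) (integrable_im_gaussianC t), integral_im_gaussianC]
  simp

/-- Optional stopping for the imaginary part. -/
lemma setIntegral_im_hitVal {C : Set ℂ} (hC : IsClosed C) (t : ℝ≥0) (z : ℂ) {B : ℝ}
    (hB : ∀ᵐ f ∂BM.law z, |(hitVal C t f).im| ≤ B) :
    ∫ f in (Stay Cᶜ t)ᶜ, (f.1 t).im ∂BM.law z = ∫ f, (hitVal C t f).im ∂BM.law z := by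
  have hv := measurable_hitVal hC t
  have hd : Measurable fun f : CPath => f.1 t - hitVal C t f := (measurable_eval t).sub hv
  have hA := (measurableSet_stay hC.isOpen_compl t).compl
  have hint : Integrable (fun f => (hitVal C t f).im) (BM.law z) :=
    Integrable.of_bound (Complex.measurable_im.comp hv).aestronglyMeasurable B hB
  have h2 := BM.map_hitVal_symm hC t z Complex.continuous_conj gaussianC_map_conj
  have hm : Measurable fun p : ℂ × ℂ => p.2.im := Complex.measurable_im.comp measurable_snd
  have h3 := congrArg (fun ν => ∫ p : ℂ × ℂ, p.2.im ∂ν) h2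
  have hm1 : Measurable fun f : CPath =>
      (hitVal C t f, (starRingEnd ℂ) (f.1 t - hitVal C t f)) :=
    hv.prodMk (Complex.continuous_conj.measurable.comp hd)
  rw [integral_map hm1.aemeasurable
    hm.aestronglyMeasurable, integral_map (hv.prodMk hd).aemeasurable
    hm.aestronglyMeasurable] at h3
  simp only [Complex.conj_im, integral_neg, Complex.sub_im] at h3
  rw [integral_sub (BM.integrable_im z t).integrableOn hint.integrableOn] at h3
  have h4 : ∫ f in (Stay Cᶜ t)ᶜ, (hitVal C t f).im ∂BM.law z =
      ∫ f, (hitVal C t f).im ∂BM.law z := by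
    refine setIntegral_eq_integral_of_forall_compl_eq_zero fun f hf => ?_
    rw [hitVal_of_mem (by simpa using hf), Complex.zero_im]
  linarith

/-- Brownian motion killed on `{Im ≤ H}` retains mean height at least `Im z - H`. -/
lemma le_lintegral_im_halfPlane {H : ℝ} (hH : 0 ≤ H) {z : ℂ} (hz : H < z.im) (t : ℝ≥0) :
    ENNReal.ofReal (z.im - H) ≤
      ∫⁻ f in Stay {x : ℂ | H < x.im} t, ENNReal.ofReal (f.1 t).im ∂BM.law z := by
  have hC : IsClosed {x : ℂ | x.im ≤ H} := isClosed_le Complex.continuous_im continuous_const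
  have hCc : {x : ℂ | x.im ≤ H}ᶜ = {x : ℂ | H < x.im} := by ext x; simp
  have hval : ∀ᵐ f ∂BM.law z, f ∉ Stay {x : ℂ | x.im ≤ H}ᶜ t →
      (hitVal {x : ℂ | x.im ≤ H} t f).im = H := by
    filter_upwards [BM.law_start z] with f hf h
    rw [hitVal_of_notMem h]
    exact frontier_im_le H (apply_hitT_mem_frontier hC h (by
      rw [hf]; simpa using hz))
  have hle : ∀ᵐ f ∂BM.law z, |(hitVal {x : ℂ | x.im ≤ H} t f).im| ≤ H := by
    filter_upwards [hval] with f hf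
    by_cases h : f ∈ Stay {x : ℂ | x.im ≤ H}ᶜ t
    · simpa [hitVal_of_mem h] using hH
    · rw [hf h, abs_of_nonneg hH]
  have hm : MeasurableSet (Stay {x : ℂ | x.im ≤ H}ᶜ t) := measurableSet_stay hC.isOpen_compl t
  have h1 := BM.setIntegral_im_hitVal hC t z hle
  have h2 : ∫ f, (hitVal {x : ℂ | x.im ≤ H} t f).im ∂BM.law z ≤ H := by
    have : ∫ f, (hitVal {x : ℂ | x.im ≤ H} t f).im ∂BM.law z ≤ ∫ _, H ∂BM.law z := by
      refine integral_mono_ae (Integrable.of_bound (Complex.measurable_im.comp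
        (measurable_hitVal hC t)).aestronglyMeasurable H hle) (integrable_const H) ?_
      filter_upwards [hle] with f hf using (le_abs_self _).trans hf
    simpa using this
  have h3 := integral_add_compl hm (BM.integrable_im z t)
  rw [BM.integral_im, h1] at h3
  rw [hCc] at h3 hm
  rw [← ofReal_integral_eq_lintegral_ofReal (BM.integrable_im z t).integrableOn]
  · apply ENNReal.ofReal_le_ofReal
    linarith
  · filter_upwards [ae_restrict_mem hm] with f hf
    exact hH.trans (hf t le_rfl).le

lemma tendsto_setIntegral_im {G : Set ℂ} (hG : G ⊆ UH) (hGo : IsOpen (UH \ G)) {H : ℝ}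
    (hH : 0 ≤ H) (hGH : ∀ x ∈ G, x.im ≤ H) {z : ℂ} (hz : z ∈ UH \ G) :
    Tendsto (fun n : ℕ => ∫ f in (Stay (UH \ G) n)ᶜ, (f.1 n).im ∂BM.law z) atTop
      (𝓝 (∫ ω, imAtHit (fun t => BM.Z t ω) G ∂BM.P z)) := by
  have hb : ∀ n : ℕ, ∀ᵐ f ∂BM.law z, |(hitVal (UH \ G)ᶜ n f).im| ≤ H := fun n => by
    filter_upwards [BM.law_start z] with f hf
    exact abs_im_hitVal_le hG hGo hH hGH n (by rwa [hf])
  have hm : ∀ n : ℕ, Measurable fun f => (hitVal (UH \ G)ᶜ n f).im := fun n =>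
    Complex.measurable_im.comp (measurable_hitVal hGo.isClosed_compl n)
  have h1 : ∀ n : ℕ, ∫ f in (Stay (UH \ G) n)ᶜ, (f.1 n).im ∂BM.law z =
      ∫ ω, (hitVal (UH \ G)ᶜ n (BM.pathOf ω)).im ∂BM.P z := fun n => by
    have := BM.setIntegral_im_hitVal hGo.isClosed_compl n z (hb n)
    rw [compl_compl] at this
    rw [this, law, integral_map (BM.aemeasurable_pathOf z) (hm n).aestronglyMeasurable]
  simp only [h1]
  refine tendsto_integral_of_dominated_convergence (fun _ => H)
    (fun n => ((hm n).comp_aemeasurable (BM.aemeasurable_pathOf z)).aestronglyMeasurable)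
    (integrable_const H) (fun n => ae_of_ae_map (BM.aemeasurable_pathOf z) (hb n)) ?_
  filter_upwards [BM.ae_pathOf z, BM.start z] with ω hω h0
  refine tendsto_im_hitVal hG hGo ?_ fun t => by rw [hω]
  rw [hω]
  simpa [h0] using hz

/-- Mass retained between two nested obstacles bounds the difference of mean hitting heights. -/
lemma add_le_integral_imAtHit {G G' : Set ℂ} (hGG' : G ⊆ G') (hG' : G' ⊆ UH)
    (hGo : IsOpen (UH \ G)) (hGo' : IsOpen (UH \ G')) {H : ℝ} (hH : 0 ≤ H)
    (hGH : ∀ x ∈ G', x.im ≤ H) {z : ℂ} (hz : z ∈ UH \ G') {δ : ℝ}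
    (hev : ∀ᶠ n : ℕ in atTop, ENNReal.ofReal δ ≤
      ∫⁻ f in Stay (UH \ G) n \ Stay (UH \ G') n, ENNReal.ofReal (f.1 n).im ∂BM.law z) :
    ∫ ω, imAtHit (fun t => BM.Z t ω) G ∂BM.P z + δ ≤
      ∫ ω, imAtHit (fun t => BM.Z t ω) G' ∂BM.P z := by
  have t1 := BM.tendsto_setIntegral_im (hGG'.trans hG') hGo hH (fun x hx => hGH x (hGG' hx))
    (z := z) ⟨hz.1, fun h => hz.2 (hGG' h)⟩
  have t2 := BM.tendsto_setIntegral_im hG' hGo' hH hGH hz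
  refine le_of_tendsto_of_tendsto (t1.add_const δ) t2 ?_
  filter_upwards [hev] with n hn
  have m1 := measurableSet_stay hGo n
  have m2 := measurableSet_stay hGo' n
  have hsub : Stay (UH \ G') n ⊆ Stay (UH \ G) n :=
    stay_mono (Set.sdiff_subset_sdiff_right hGG') n
  have hdec : (Stay (UH \ G') (n : ℝ≥0))ᶜ =
      (Stay (UH \ G) (n : ℝ≥0))ᶜ ∪ (Stay (UH \ G) n \ Stay (UH \ G') n) := by
    ext f
    have := @hsub f
    simp only [Set.mem_compl_iff, Set.mem_union, Set.mem_sdiff]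
    tauto
  have hdisj : Disjoint (Stay (UH \ G) (n : ℝ≥0))ᶜ (Stay (UH \ G) n \ Stay (UH \ G') n) :=
    Set.disjoint_left.2 fun f h1 h2 => h1 h2.1
  rw [hdec, setIntegral_union hdisj (m1.diff m2)
    (BM.integrable_im z n).integrableOn (BM.integrable_im z n).integrableOn]
  rw [← ofReal_integral_eq_lintegral_ofReal (BM.integrable_im z n).integrableOn] at hn
  · have h0 : 0 ≤ ∫ f in Stay (UH \ G) n \ Stay (UH \ G') n, (f.1 n).im ∂BM.law z :=
      setIntegral_nonneg (m1.diff m2) fun f hf => le_of_lt (hf.1 n le_rfl).1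
    have := (ENNReal.ofReal_le_ofReal_iff h0).1 hn
    linarith
  · filter_upwards [ae_restrict_mem (m1.diff m2)] with f hf
    exact le_of_lt (hf.1 n le_rfl).1

end PlanarBM

/-- A set of paths determined by the path up to time `s`. -/
structure CPath.Adapted (A : Set CPath) (s : ℝ≥0) : Prop where
  measurableSet : MeasurableSet A
  freeze_mem : ∀ f, CPath.freeze s f ∈ A ↔ f ∈ A

namespace CPath

lemma adapted_stay {D : Set ℂ} (hD : IsOpen D) (t : ℝ≥0) : Adapted (Stay D t) t :=
  ⟨measurableSet_stay hD t, freeze_mem_stay le_rfl⟩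

lemma Adapted.diff {A B : Set CPath} {s : ℝ≥0} (hA : Adapted A s) (hB : Adapted B s) :
    Adapted (A \ B) s :=
  ⟨hA.1.diff hB.1, fun f => by rw [Set.mem_sdiff, Set.mem_sdiff, hA.2, hB.2]⟩

lemma shift_freeze (s t : ℝ≥0) (f : CPath) :
    shift s (freeze (s + t) f) = freeze t (shift s f) := by
  apply Subtype.ext; ext u
  simp [shift, freeze, min_add_add_left]

lemma Adapted.inter_shift {A B : Set CPath} {s t : ℝ≥0} (hA : Adapted A s) (hB : Adapted B t) :
    Adapted (A ∩ shift s ⁻¹' B) (s + t) :=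
  ⟨hA.1.inter (measurable_shift s hB.1), fun f => by
    rw [Set.mem_inter_iff, Set.mem_inter_iff, Set.mem_preimage, Set.mem_preimage, shift_freeze,
      hB.2, ← hA.2, freeze_freeze (by simp), hA.2]⟩

/-- The paths which stay in `D k` during the `k`-th of `n` successive periods `τ k`. -/
def tube (D : ℕ → Set ℂ) (τ : ℕ → ℝ≥0) : ℕ → Set CPath
  | 0 => Set.univ
  | n + 1 => tube D τ n ∩ shift (∑ i ∈ Finset.range n, τ i) ⁻¹' Stay (D n) (τ n)

lemma adapted_tube {D : ℕ → Set ℂ} (hD : ∀ k, IsOpen (D k)) (τ : ℕ → ℝ≥0) (n : ℕ) :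
    Adapted (tube D τ n) (∑ i ∈ Finset.range n, τ i) := by
  induction n with
  | zero => exact ⟨MeasurableSet.univ, fun f => Iff.rfl⟩
  | succ n ih =>
    rw [Finset.sum_range_succ]
    exact ih.inter_shift (adapted_stay (hD n) _)

lemma tube_subset_stay {D : ℕ → Set ℂ} {U : Set ℂ} (hD : ∀ k, D k ⊆ U) (τ : ℕ → ℝ≥0) (n : ℕ) :
    tube D τ (n + 1) ⊆ Stay U (∑ i ∈ Finset.range (n + 1), τ i) := by
  induction n with
  | zero =>
    rintro f ⟨-, hf⟩ s hs
    have := hf s (by simpa using hs)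
    exact hD 0 (by simpa [shift] using this)
  | succ n ih =>
    rintro f ⟨h1, h2⟩
    rw [Finset.sum_range_succ]
    exact mem_stay_add.2 ⟨ih h1, stay_mono (hD _) _ h2⟩

lemma mem_of_mem_tube {D : ℕ → Set ℂ} {τ : ℕ → ℝ≥0} {n : ℕ} {f : CPath} (hf : f ∈ tube D τ n)
    {k : ℕ} (hk : k < n) {t : ℝ≥0} (h1 : ∑ i ∈ Finset.range k, τ i ≤ t)
    (h2 : t ≤ ∑ i ∈ Finset.range (k + 1), τ i) : f.1 t ∈ D k := by
  induction n with
  | zero => simp at hk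
  | succ n ih =>
    rcases Nat.lt_succ_iff_lt_or_eq.1 hk with h | rfl
    · exact ih hf.1 h
    · rw [Finset.sum_range_succ] at h2
      have := hf.2 (t - ∑ i ∈ Finset.range k, τ i) (tsub_le_iff_left.2 h2)
      rwa [shift_apply, add_tsub_cancel_of_le h1] at this

end CPath

namespace PlanarBM

open CPath

variable {Ω : Type*} [MeasurableSpace Ω] (BM : PlanarBM Ω)

/-- The law of the position at time `t` on the event `A`. -/
noncomputable def posOn (A : Set CPath) (t : ℝ≥0) (z : ℂ) : Measure ℂ :=
  ((BM.law z).restrict A).map fun f => f.1 t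

lemma posOn_apply (A : Set CPath) (t : ℝ≥0) (z : ℂ) {B : Set ℂ} (hB : MeasurableSet B) :
    BM.posOn A t z B = BM.law z ((fun f => f.1 t) ⁻¹' B ∩ A) := by
  rw [posOn, Measure.map_apply (measurable_eval t) hB,
    Measure.restrict_apply (measurable_eval t hB)]

lemma le_setLIntegral_shift {A : Set CPath} {s : ℝ≥0} (hA : Adapted A s) {z : ℂ}
    {g : CPath → ℝ≥0∞} (hg : Measurable g) {c η : ℝ≥0∞} {V V' : Set ℂ}
    (hV : V' ⊆ V) (hc : c • volume.restrict V ≤ BM.posOn A s z)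
    (hη : ∀ x ∈ V', η ≤ ∫⁻ h, g h ∂BM.law x) :
    c * volume V' * η ≤ ∫⁻ f in A, g (shift s f) ∂BM.law z := by
  have hG : Measurable fun x => ∫⁻ h, g h ∂BM.law x :=
    BM.measurable_lintegral_law (g := fun p : ℂ × CPath => g p.2) measurable_id
      (hg.comp measurable_snd)
  have h1 : ∫⁻ f in A, g (shift s f) ∂BM.law z = ∫⁻ x, ∫⁻ h, g h ∂BM.law x ∂BM.posOn A s z := by
    rw [BM.setLIntegral_shift s z hA.1 hA.2 hg, posOn, lintegral_map hG (measurable_eval s)]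
  rw [h1]
  refine le_trans ?_ (lintegral_mono' hc le_rfl)
  rw [lintegral_smul_measure, smul_eq_mul, mul_assoc]
  gcongr
  refine le_trans ?_ (lintegral_mono' (Measure.restrict_mono hV le_rfl) le_rfl)
  calc volume V' * η = ∫⁻ _ in V', η := by rw [setLIntegral_const, mul_comm]
    _ ≤ _ := setLIntegral_mono hG fun x hx => hη x hx

lemma le_posOn_inter_shift {A E : Set CPath} {s t : ℝ≥0} (hA : Adapted A s)
    (hE : MeasurableSet E) {z : ℂ} {V V' W : Set ℂ} {c d : ℝ≥0∞}
    (hV : V' ⊆ V) (h1 : c • volume.restrict V ≤ BM.posOn A s z)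
    (h2 : ∀ x ∈ V', d • volume.restrict W ≤ BM.posOn E t x) :
    (c * volume V' * d) • volume.restrict W ≤ BM.posOn (A ∩ shift s ⁻¹' E) (s + t) z := by
  refine Measure.le_iff.2 fun B hB => ?_
  have hm : MeasurableSet ((fun f : CPath => f.1 t) ⁻¹' B ∩ E) := (measurable_eval t hB).inter hE
  rw [posOn_apply _ _ _ _ hB, Measure.smul_apply, smul_eq_mul, mul_assoc]
  have h3 := BM.le_setLIntegral_shift hA (g := ((fun f : CPath => f.1 t) ⁻¹' B ∩ E).indicator 1)
    (measurable_one.indicator hm) (η := d * volume.restrict W B) hV h1 (fun x hx => by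
      rw [lintegral_indicator_one hm, ← posOn_apply _ _ _ _ hB]
      exact h2 x hx B)
  refine h3.trans (le_of_eq ?_)
  have h4 : (fun f => ((fun f : CPath => f.1 t) ⁻¹' B ∩ E).indicator (1 : CPath → ℝ≥0∞)
      (shift s f)) = (shift s ⁻¹' ((fun f : CPath => f.1 t) ⁻¹' B ∩ E)).indicator 1 := by
    ext f
    rfl
  rw [h4, lintegral_indicator_one (measurable_shift s hm),
    Measure.restrict_apply (measurable_shift s hm)]
  congr 1
  ext f
  simp only [Set.mem_inter_iff, Set.mem_preimage, shift_apply]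
  tauto

lemma exists_le_posOn_tube {D : ℕ → Set ℂ} (hD : ∀ k, IsOpen (D k))
    (hDc : ∀ k, IsPreconnected (D k)) {b : ℕ → ℂ} (h1 : ∀ k, b k ∈ D k)
    (h2 : ∀ k, b (k + 1) ∈ D k) :
    ∃ τ : ℕ → ℝ≥0, ∀ n, ∃ (c : ℝ≥0∞) (r : ℝ), c ≠ 0 ∧ 0 < r ∧ ∀ z ∈ Metric.ball (b 0) r,
      c • volume.restrict (Metric.ball (b (n + 1)) r) ≤
        BM.posOn (tube D τ (n + 1)) (∑ i ∈ Finset.range (n + 1), τ i) z := by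
  choose τ c r hc hr h using fun k => BM.exists_le_killed (hD k) (hDc k) (h1 k) (h2 k)
  refine ⟨τ, fun n => ?_⟩
  induction n with
  | zero =>
    refine ⟨c 0, r 0, hc 0, hr 0, fun z hz => ?_⟩
    convert! h 0 z hz using 1
    have : tube D τ (0 + 1) = Stay (D 0) (τ 0) := by
      ext f
      simp [tube, shift]
    rw [this, Finset.sum_range_one]
    rfl
  | succ n ih =>
    obtain ⟨c', r', hc', hr', h'⟩ := ih
    have hmin : 0 < min r' (r (n + 1)) := lt_min hr' (hr _)
    refine ⟨c' * volume (Metric.ball (b (n + 1)) (min r' (r (n + 1)))) * c (n + 1),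
      min r' (r (n + 1)), ?_, hmin, fun z hz => ?_⟩
    · exact mul_ne_zero (mul_ne_zero hc' (Metric.measure_ball_pos volume _ hmin).ne') (hc _)
    · rw [Finset.sum_range_succ _ (n + 1)]
      refine BM.le_posOn_inter_shift (adapted_tube hD τ (n + 1)) (measurableSet_stay (hD _) _)
        (Metric.ball_subset_ball (min_le_left _ _))
        (h' z (Metric.ball_subset_ball (min_le_left _ _) hz)) fun x hx => ?_
      refine le_trans ?_ (h (n + 1) x (Metric.ball_subset_ball (min_le_right _ _) hx))
      gcongr
      exact min_le_right _ _

end PlanarBM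

/-- A continuous logarithm on a preconnected set is determined by one value. -/
lemma IsPreconnected.sub_eq_sub_of_exp_eq {α : Type*} [TopologicalSpace α] {S : Set α}
    (hS : IsPreconnected S) {φ ψ : α → ℂ} (hφ : ContinuousOn φ S) (hψ : ContinuousOn ψ S) {u : ℂ}
    (h : ∀ x ∈ S, Complex.exp (φ x) = u * Complex.exp (ψ x)) {x y : α} (hx : x ∈ S) (hy : y ∈ S) :
    φ x - ψ x = φ y - ψ y := by
  have hu : u ≠ 0 := by
    rintro rfl
    simpa using h x hx
  set χ : α → ℝ := fun z => (φ z - ψ z - (φ y - ψ y)).im / (2 * Real.pi) with hχ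
  have hint : ∀ z ∈ S, ∃ n : ℤ, φ z - ψ z - (φ y - ψ y) = n * (2 * Real.pi * Complex.I) := by
    intro z hz
    rw [← Complex.exp_eq_one_iff, Complex.exp_sub, Complex.exp_sub, Complex.exp_sub, h z hz, h y hy]
    have := Complex.exp_ne_zero (ψ z)
    have := Complex.exp_ne_zero (ψ y)
    field_simp
  have hχc : ContinuousOn χ S := by
    refine ContinuousOn.div_const (Complex.continuous_im.comp_continuousOn ?_) _
    exact (hφ.sub hψ).sub continuousOn_const
  have hχint : ∀ z ∈ S, ∃ n : ℤ, χ z = n ∧ φ z - ψ z - (φ y - ψ y) = n * (2 * Real.pi * Complex.I) := by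
    intro z hz
    obtain ⟨n, hn⟩ := hint z hz
    refine ⟨n, ?_, hn⟩
    have hpi := Real.pi_pos.ne'
    rw [hχ]
    simp only [hn]
    simp
  obtain ⟨n, hn, hn'⟩ := hχint x hx
  have hy0 : χ y = 0 := by simp [hχ]
  have hconn := (hS.image χ hχc).ordConnected
  have hn0 : n = 0 := by
    by_contra hne
    rcases lt_or_gt_of_ne hne with hneg | hpos
    · have : (n : ℝ) ≤ -1 := by exact_mod_cast Int.le_sub_one_of_lt hneg
      obtain ⟨z, hz, hz'⟩ := hconn.out ⟨x, hx, rfl⟩ ⟨y, hy, rfl⟩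
        (show (-1 / 2 : ℝ) ∈ Set.Icc (χ x) (χ y) by rw [hn, hy0]; constructor <;> linarith)
      obtain ⟨k, hk, -⟩ := hχint z hz
      have h2 : ((2 * k : ℤ) : ℝ) = ((-1 : ℤ) : ℝ) := by push_cast; linarith
      have := Int.cast_injective h2
      omega
    · have : (1 : ℝ) ≤ n := by exact_mod_cast hpos
      obtain ⟨z, hz, hz'⟩ := hconn.out ⟨y, hy, rfl⟩ ⟨x, hx, rfl⟩
        (show (1 / 2 : ℝ) ∈ Set.Icc (χ y) (χ x) by rw [hn, hy0]; constructor <;> linarith)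
      obtain ⟨k, hk, -⟩ := hχint z hz
      have h2 : ((2 * k : ℤ) : ℝ) = ((1 : ℤ) : ℝ) := by push_cast; linarith
      have := Int.cast_injective h2
      omega
  rw [hn0] at hn'
  simp only [Int.cast_zero, zero_mul] at hn'
  linear_combination hn'

/-- Every compact subset of `D` carries a continuous logarithm of `z - w`. -/
def LogOnCompacts (D : Set ℂ) (w : ℂ) : Prop :=
  ∀ K, IsCompact K → K ⊆ D → ∃ g : ℂ → ℂ, ContinuousOn g K ∧ ∀ z ∈ K, Complex.exp (g z) = z - w

/-- The `k`-th quadrant coordinate around `w`. -/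
noncomputable def quad (w u : ℂ) (k : ℕ) (z : ℂ) : ℂ := (z - w) / (u * Complex.I ^ k)

lemma continuous_quad (w u : ℂ) (k : ℕ) : Continuous (quad w u k) := by
  unfold quad; fun_prop

lemma quad_succ (w u z : ℂ) (k : ℕ) : quad w u k z = quad w u (k + 1) z * Complex.I := by
  have := Complex.I_ne_zero
  unfold quad
  rw [pow_succ, ← mul_assoc, div_mul_eq_mul_div, mul_div_mul_right _ _ this]

/-- The branch of the logarithm on the `k`-th half-plane around `w`. -/
noncomputable def quadLog (w u : ℂ) (k : ℕ) (z : ℂ) : ℂ :=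
  Complex.log (quad w u k z) + k * (Real.pi / 2 * Complex.I)

/-- The half-planes around `w`, rotated by quarter turns, within a ball. -/
def halfBall (w u : ℂ) (a : ℝ) (k : ℕ) : Set ℂ := {z | 0 < (quad w u k z).re} ∩ Metric.ball w a

lemma continuousOn_quadLog (w u : ℂ) (a : ℝ) (k : ℕ) :
    ContinuousOn (quadLog w u k) (halfBall w u a k) := by
  refine ContinuousOn.add (ContinuousOn.clog (continuous_quad w u k).continuousOn
    fun z hz => ?_) continuousOn_const
  exact Or.inl hz.1

lemma quadLog_succ {w u z : ℂ} {k : ℕ} (h1 : 0 < (quad w u (k + 1) z).re) :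
    quadLog w u k z = quadLog w u (k + 1) z := by
  have hne : quad w u (k + 1) z ≠ 0 := by
    intro h; simp [h] at h1
  have harg := Complex.abs_arg_lt_pi_div_two_iff.2 (Or.inl h1)
  rw [abs_lt] at harg
  have h2 : Complex.log (quad w u k z) =
      Complex.log (quad w u (k + 1) z) + Real.pi / 2 * Complex.I := by
    rw [quad_succ w u z k]
    have hexp : quad w u (k + 1) z * Complex.I =
        Complex.exp (Complex.log (quad w u (k + 1) z) + Real.pi / 2 * Complex.I) := by
      rw [Complex.exp_add, Complex.exp_log hne, Complex.exp_pi_div_two_mul_I]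
    rw [hexp, Complex.log_exp]
    · simp [Complex.log_im]; linarith
    · simp [Complex.log_im]; linarith
  unfold quadLog
  rw [h2]
  push_cast
  ring

lemma quad_pow_mul {w v : ℂ} (hv : v ≠ w) (k : ℕ) :
    quad w ((v - w) * (1 + Complex.I)) k (w + (v - w) * Complex.I ^ k) = (1 - Complex.I) / 2 := by
  have h1 : v - w ≠ 0 := sub_ne_zero.2 hv
  have h2 : (1 + Complex.I) ≠ 0 := fun h => by simpa using congrArg Complex.re h
  unfold quad
  rw [div_eq_div_iff (by simp [h1, h2]) two_ne_zero]
  ring_nf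
  simp
  ring

lemma exp_quadLog {w u z : ℂ} (hu : u ≠ 0) {k : ℕ} (hz : 0 < (quad w u k z).re) :
    u * Complex.exp (quadLog w u k z) = z - w := by
  have hne : quad w u k z ≠ 0 := by
    intro h; simp [h] at hz
  have hk : Complex.exp (k * (Real.pi / 2 * Complex.I)) = Complex.I ^ k := by
    rw [Complex.exp_nat_mul, Complex.exp_pi_div_two_mul_I]
  unfold quadLog
  rw [Complex.exp_add, Complex.exp_log hne, hk]
  unfold quad
  have := Complex.I_ne_zero
  field_simp

lemma isOpen_halfBall (w u : ℂ) (a : ℝ) (k : ℕ) : IsOpen (halfBall w u a k) :=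
  (isOpen_lt continuous_const (Complex.continuous_re.comp (continuous_quad w u k))).inter
    Metric.isOpen_ball

lemma convex_halfBall (w u : ℂ) (a : ℝ) (k : ℕ) : Convex ℝ (halfBall w u a k) := by
  refine Convex.inter ?_ (convex_ball w a)
  intro x hx y hy s t hs ht hst
  have e : quad w u k (s • x + t • y) = s • quad w u k x + t • quad w u k y := by
    unfold quad
    have : (t : ℂ) = 1 - s := by rw [← Complex.ofReal_one, ← hst]; push_cast; ring
    simp only [Complex.real_smul, this]
    ring
  simp only [Set.mem_ofPred_eq] at hx hy ⊢
  rw [e]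
  simp only [Complex.add_re, Complex.real_smul, Complex.re_ofReal_mul]
  rcases hs.eq_or_lt with rfl | hs'
  · have : t = 1 := by linarith
    subst this; simpa using hy
  · have := mul_pos hs' hx
    have := mul_nonneg ht hy.le
    linarith

/-- No loop in a set with continuous logarithms of `z - w` turns around `w`. -/
lemma LogOnCompacts.not_turn {D : Set ℂ} {w u : ℂ} (hD : LogOnCompacts D w) (hu : u ≠ 0) {a : ℝ}
    {τ : ℕ → ℝ≥0} {f : CPath} (hf : f ∈ CPath.tube (halfBall w u a) τ 4)
    (hfD : f ∈ CPath.Stay D (∑ i ∈ Finset.range 4, τ i)) {S : Set ℂ} (hS : Convex ℝ S)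
    (hSD : S ⊆ D) (hS0 : S ⊆ halfBall w u a 0) (h0 : f.1 0 ∈ S)
    (h1 : f.1 (∑ i ∈ Finset.range 4, τ i) ∈ S) : False := by
  set s : ℕ → ℝ≥0 := fun k => ∑ i ∈ Finset.range k, τ i with hs
  have hsmono : ∀ k, s k ≤ s (k + 1) := fun k => by
    simp only [hs, Finset.sum_range_succ]; exact le_self_add
  have hsm : Monotone s := monotone_nat_of_le_succ hsmono
  set L := segment ℝ (f.1 (s 4)) (f.1 0) with hL
  have hLS : L ⊆ S := hS.segment_subset h1 h0
  obtain ⟨g, hg, hgexp⟩ := hD (f.1 '' Set.Icc 0 (s 4) ∪ L)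
    ((isCompact_Icc.image f.2).union (by
      rw [hL, ← Path.range_segment]
      exact isCompact_range (Path.segment _ _).continuous)) (by
    refine Set.union_subset ?_ (hLS.trans hSD)
    rintro _ ⟨t, ht, rfl⟩
    exact hfD t ht.2)
  have hstep : ∀ k < 4, g (f.1 (s k)) - quadLog w u k (f.1 (s k)) =
      g (f.1 (s (k + 1))) - quadLog w u k (f.1 (s (k + 1))) := by
    intro k hk
    have hmem : ∀ t ∈ Set.Icc (s k) (s (k + 1)), f.1 t ∈ halfBall w u a k := fun t ht =>
      CPath.mem_of_mem_tube hf hk ht.1 ht.2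
    have hK : ∀ t ∈ Set.Icc (s k) (s (k + 1)), f.1 t ∈ f.1 '' Set.Icc 0 (s 4) ∪ L := fun t ht =>
      Or.inl ⟨t, ⟨bot_le, ht.2.trans (hsm (by omega))⟩, rfl⟩
    refine (isPreconnected_Icc (a := s k) (b := s (k + 1))).sub_eq_sub_of_exp_eq
      (φ := fun t => g (f.1 t)) (ψ := fun t => quadLog w u k (f.1 t)) (u := u)
      (hg.comp f.2.continuousOn hK) ((continuousOn_quadLog w u a k).comp f.2.continuousOn hmem)
      (fun t ht => ?_) (Set.left_mem_Icc.2 (hsmono k)) (Set.right_mem_Icc.2 (hsmono k))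
    rw [hgexp _ (hK t ht), exp_quadLog hu (hmem t ht).1]
  have hpass : ∀ k, k + 1 < 4 → quadLog w u k (f.1 (s (k + 1))) =
      quadLog w u (k + 1) (f.1 (s (k + 1))) := fun k hk =>
    quadLog_succ (CPath.mem_of_mem_tube hf hk le_rfl (hsmono _)).1
  have hq4 : ∀ z, quad w u 4 z = quad w u 0 z := fun z => by
    unfold quad; rw [Complex.I_pow_four, pow_zero]
  have h34 : quadLog w u 3 (f.1 (s 4)) = quadLog w u 4 (f.1 (s 4)) :=
    quadLog_succ (by rw [hq4]; exact (hS0 h1).1)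
  have h40 : quadLog w u 4 (f.1 (s 4)) = quadLog w u 0 (f.1 (s 4)) + 2 * Real.pi * Complex.I := by
    unfold quadLog; rw [hq4]; push_cast; ring
  have hs0 : s 0 = 0 := by simp [hs]
  have hend : g (f.1 (s 4)) - quadLog w u 0 (f.1 (s 4)) = g (f.1 0) - quadLog w u 0 (f.1 0) := by
    refine (convex_segment (𝕜 := ℝ) (f.1 (s 4)) (f.1 0)).isPreconnected.sub_eq_sub_of_exp_eq
      (u := u) (hg.mono Set.subset_union_right)
      ((continuousOn_quadLog w u a 0).mono (hLS.trans hS0)) (fun z hz => ?_)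
      (left_mem_segment ℝ _ _) (right_mem_segment ℝ _ _)
    rw [hgexp _ (Or.inr hz), exp_quadLog hu (hS0 (hLS hz)).1]
  have e0 := hstep 0 (by norm_num)
  have e1 := hstep 1 (by norm_num)
  have e2 := hstep 2 (by norm_num)
  have e3 := hstep 3 (by norm_num)
  have p0 := hpass 0 (by norm_num)
  have p1 := hpass 1 (by norm_num)
  have p2 := hpass 2 (by norm_num)
  simp only [hs0, Nat.reduceAdd, zero_add] at e0 e1 e2 e3 p0 p1 p2
  have : 2 * Real.pi * Complex.I = 0 := by
    linear_combination e0 + e1 + e2 + e3 - p0 - p1 - p2 - h34 - h40 + hend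
  simp [Real.pi_ne_zero] at this

namespace PlanarBM

open CPath

variable {Ω : Type*} [MeasurableSpace Ω] (BM : PlanarBM Ω)

/-- Brownian motion started close to a point `w` outside `D` leaves `D` while turning around `w`,
and comes back to its starting region. -/
lemma exists_le_posOn_diff {D U : Set ℂ} (hDo : IsOpen D) {w v : ℂ} {a : ℝ}
    (hwD : w ∉ D) (hD : LogOnCompacts D w) (haU : Metric.ball w a ⊆ U)
    (hv : v ∈ Metric.ball w a) (hvD : v ∈ D) :
    ∃ (T : ℝ≥0) (c : ℝ≥0∞) (r : ℝ), c ≠ 0 ∧ 0 < r ∧ ∀ z ∈ Metric.ball v r,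
      c • volume.restrict (Metric.ball v r) ≤ BM.posOn (Stay U T \ Stay D T) T z := by
  have hvw : v ≠ w := fun h => hwD (h ▸ hvD)
  set u := (v - w) * (1 + Complex.I) with hu
  have hu0 : u ≠ 0 := by
    refine mul_ne_zero (sub_ne_zero.2 hvw) fun h => ?_
    simpa using congrArg Complex.re h
  set b : ℕ → ℂ := fun k => w + (v - w) * Complex.I ^ k with hb
  have hball : ∀ k, b k ∈ Metric.ball w a := fun k => by
    rw [Metric.mem_ball, dist_eq_norm] at hv ⊢
    simpa [hb] using hv
  have hb1 : ∀ k, b k ∈ halfBall w u a k := fun k => by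
    refine ⟨?_, hball k⟩
    change 0 < (quad w u k (b k)).re
    rw [hu, hb, quad_pow_mul hvw]
    norm_num
  have hb2 : ∀ k, b (k + 1) ∈ halfBall w u a k := fun k => by
    refine ⟨?_, hball _⟩
    change 0 < (quad w u k (b (k + 1))).re
    rw [quad_succ, hu, hb, quad_pow_mul hvw]
    norm_num
  have hb0 : b 0 = v := by simp [hb]
  have hb4 : b 4 = v := by simp [hb, Complex.I_pow_four]
  obtain ⟨τ, hτ⟩ := BM.exists_le_posOn_tube (isOpen_halfBall w u a)
    (fun k => (convex_halfBall w u a k).isPreconnected) hb1 hb2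
  obtain ⟨c, r, hc, hr, h⟩ := hτ 3
  simp only [Nat.reduceAdd] at h
  rw [hb0, hb4] at h
  obtain ⟨ε, hε, hεs⟩ := Metric.isOpen_iff.1 (hDo.inter (isOpen_halfBall w u a 0)) v
    ⟨hvD, hb0 ▸ hb1 0⟩
  refine ⟨∑ i ∈ Finset.range 4, τ i, c, min r ε, hc, lt_min hr hε, fun z hz => ?_⟩
  have hz1 := Metric.ball_subset_ball (min_le_left r ε) hz
  have hsub : Metric.ball v (min r ε) ⊆ D ∩ halfBall w u a 0 :=
    (Metric.ball_subset_ball (min_le_right r ε)).trans hεs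
  refine Measure.le_iff.2 fun A hA => ?_
  have hA' : MeasurableSet (A ∩ Metric.ball v (min r ε)) := hA.inter Metric.isOpen_ball.measurableSet
  rw [Measure.smul_apply, Measure.restrict_apply hA, posOn_apply _ _ _ _ hA]
  calc c • volume (A ∩ Metric.ball v (min r ε))
      = (c • volume.restrict (Metric.ball v r)) (A ∩ Metric.ball v (min r ε)) := by
        rw [Measure.smul_apply, Measure.restrict_apply hA', Set.inter_assoc,
          Set.inter_eq_left.2 (Metric.ball_subset_ball (min_le_left r ε))]
    _ ≤ _ := h z hz1 _
    _ = _ := posOn_apply _ _ _ _ hA'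
    _ ≤ _ := by
      refine measure_mono_ae ?_
      filter_upwards [BM.law_start z] with f hf
      rintro ⟨⟨hfA, hfB⟩, hft⟩
      refine ⟨hfA, tube_subset_stay (fun k => Set.inter_subset_right.trans haU) τ 3 hft,
        fun hfD => ?_⟩
      exact hD.not_turn hu0 hft hfD (convex_ball v (min r ε))
        (hsub.trans Set.inter_subset_left) (hsub.trans Set.inter_subset_right) (hf ▸ hz) hfB

end PlanarBM

lemma exists_ofReal_le {K : ℝ≥0∞} (hK : K ≠ 0) : ∃ q : ℝ, 0 < q ∧ ENNReal.ofReal q ≤ K := by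
  obtain ⟨q, hq0, hq⟩ := ENNReal.lt_iff_exists_nnreal_btwn.1 (pos_iff_ne_zero.2 hK)
  refine ⟨q, by exact_mod_cast hq0, ?_⟩
  rw [ENNReal.ofReal_coe_nnreal]
  exact hq.le

lemma CPath.setLIntegral_shift_indicator (μ : Measure CPath) (A : Set CPath) {B : Set CPath}
    (hB : MeasurableSet B) {τ : ℝ≥0} (g : CPath → ℝ≥0∞) :
    ∫⁻ f in A, B.indicator g (shift τ f) ∂μ =
      ∫⁻ f in A ∩ shift τ ⁻¹' B, g (shift τ f) ∂μ := by
  rw [Set.inter_comm A, ← Measure.restrict_restrict (measurable_shift _ hB),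
    ← lintegral_indicator (measurable_shift _ hB)]
  rfl

namespace PlanarBM

open CPath

variable {Ω : Type*} [MeasurableSpace Ω] (BM : PlanarBM Ω)

/-- The paths which leave `D` for the first time during the period `[t, t + T]`. -/
def window (D : Set ℂ) (T t : ℝ≥0) : Set CPath := Stay D t \ Stay D (t + T)

lemma exists_le_lintegral_window {D U : Set ℂ} (hDo : IsOpen D) (hDc : IsPreconnected D)
    (hUo : IsOpen U) {H : ℝ} (hH : 0 ≤ H) (hHD : {x : ℂ | H < x.im} ⊆ D) {w v : ℂ} {a : ℝ}
    (hwD : w ∉ D) (hlog : LogOnCompacts D w) (haU : Metric.ball w a ⊆ U)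
    (hv : v ∈ Metric.ball w a) (hvD : v ∈ D) :
    ∃ (q : ℝ) (m T t₀ : ℝ≥0), 0 < q ∧ ∀ y : ℝ, 2 * H + 6 ≤ y → ∀ t : ℝ≥0, y ^ 2 ≤ t →
      t ≤ 2 * y ^ 2 → ∀ s : ℝ≥0, ENNReal.ofReal (q / y ^ 3) ≤
        ∫⁻ f in window D T (t + m) ∩ Stay (D ∪ U) (t + m + T + t₀ + s),
          ENNReal.ofReal (f.1 (t + m + T + t₀ + s)).im ∂BM.law ((y : ℂ) * Complex.I) := by
  set p : ℂ := ((H + 2 : ℝ) : ℂ) * Complex.I with hp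
  have hpim : p.im = H + 2 := by simp [hp]
  have hpD : p ∈ D := hHD (show H < p.im by rw [hpim]; linarith)
  obtain ⟨m, c₁, r₁, hc₁, hr₁, h₁⟩ := BM.exists_le_killed hDo hDc hpD hvD
  obtain ⟨T, c₂, r₂, hc₂, hr₂, h₂⟩ := BM.exists_le_posOn_diff hDo hwD hlog haU hv hvD
  obtain ⟨t₀, c₃, r₃, hc₃, hr₃, h₃⟩ := BM.exists_le_killed hDo hDc hvD hpD
  set v₁ := volume (Metric.ball p (min 1 r₁))
  set v₂ := volume (Metric.ball v (min r₁ r₂))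
  set v₃ := volume (Metric.ball v (min r₂ r₃))
  set v₄ := volume (Metric.ball p (min r₃ 1))
  have hv₁ : v₁ ≠ 0 := (Metric.measure_ball_pos volume _ (by positivity)).ne'
  have hv₂ : v₂ ≠ 0 := (Metric.measure_ball_pos volume _ (by positivity)).ne'
  have hv₃ : v₃ ≠ 0 := (Metric.measure_ball_pos volume _ (by positivity)).ne'
  have hv₄ : v₄ ≠ 0 := (Metric.measure_ball_pos volume _ (by positivity)).ne'
  obtain ⟨q, hq, hqK⟩ := exists_ofReal_le (K := v₁ * c₁ * v₂ * c₂ * v₃ * c₃ * v₄)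
    (by simp only [ne_eq, mul_eq_zero]; tauto)
  set κ := Real.exp (-1) / (16 * Real.pi)
  have hκ : 0 < κ := by positivity
  refine ⟨κ * q, m, T, t₀, by positivity, fun y hy t ht ht' s => ?_⟩
  have hy0 : 0 < y := by linarith
  have hDU : IsOpen (D ∪ U) := hDo.union hUo
  have b₀ := (BM.le_killed_halfPlane hH hy ht ht').trans (BM.killed_mono hHD t _)
  have b₁ := BM.le_posOn_inter_shift (adapted_stay hDo t) (measurableSet_stay hDo m)
    (Metric.ball_subset_ball (min_le_left 1 r₁)) b₀
    (fun x hx => h₁ x (Metric.ball_subset_ball (min_le_right _ _) hx))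
  have a₁ := (adapted_stay hDo t).inter_shift (adapted_stay hDo m)
  have aT := (adapted_stay hUo T).diff (adapted_stay hDo T)
  have b₂ := BM.le_posOn_inter_shift a₁ aT.1 (Metric.ball_subset_ball (min_le_left r₁ r₂)) b₁
    (fun x hx => h₂ x (Metric.ball_subset_ball (min_le_right _ _) hx))
  have a₂ := a₁.inter_shift aT
  have b₃ := BM.le_posOn_inter_shift a₂ (measurableSet_stay hDo t₀)
    (Metric.ball_subset_ball (min_le_left r₂ r₃)) b₂
    (fun x hx => h₃ x (Metric.ball_subset_ball (min_le_right _ _) hx))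
  have a₃ := a₂.inter_shift (adapted_stay hDo t₀)
  have hms := measurableSet_stay hDU s
  have hmg : Measurable fun f : CPath => ENNReal.ofReal (f.1 s).im :=
    (Complex.measurable_im.comp (measurable_eval s)).ennreal_ofReal
  have b₄ := BM.le_setLIntegral_shift a₃ (hmg.indicator hms) (η := 1)
    (Metric.ball_subset_ball (min_le_left r₃ 1)) b₃ (fun x hx => by
      have hx1 := Metric.ball_subset_ball (min_le_right r₃ 1) hx
      rw [Metric.mem_ball, dist_eq_norm] at hx1
      have hx2 := (Complex.abs_im_le_norm (x - p)).trans_lt hx1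
      rw [Complex.sub_im, hpim, abs_lt] at hx2
      rw [lintegral_indicator hms]
      calc (1 : ℝ≥0∞) = ENNReal.ofReal 1 := by simp
        _ ≤ ENNReal.ofReal (x.im - H) := ENNReal.ofReal_le_ofReal (by linarith)
        _ ≤ _ := BM.le_lintegral_im_halfPlane hH (by linarith) s
        _ ≤ _ := lintegral_mono_set (stay_mono (hHD.trans Set.subset_union_left) s))
  calc ENNReal.ofReal (κ * q / y ^ 3) = ENNReal.ofReal (κ / y ^ 3) * ENNReal.ofReal q := by
        rw [← ENNReal.ofReal_mul (by positivity)]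
        congr 1; ring
    _ ≤ ENNReal.ofReal (κ / y ^ 3) * (v₁ * c₁ * v₂ * c₂ * v₃ * c₃ * v₄) := by gcongr
    _ = _ := by ring
    _ ≤ _ := b₄
    _ = ∫⁻ f in (Stay D t ∩ shift t ⁻¹' Stay D m ∩ shift (t + m) ⁻¹' (Stay U T \ Stay D T) ∩
          shift (t + m + T) ⁻¹' Stay D t₀) ∩ shift (t + m + T + t₀) ⁻¹' Stay (D ∪ U) s,
          ENNReal.ofReal (f.1 (t + m + T + t₀ + s)).im ∂BM.law ((y : ℂ) * Complex.I) := by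
        exact setLIntegral_shift_indicator _ _ hms fun f => ENNReal.ofReal (f.1 s).im
    _ ≤ _ := by
        refine lintegral_mono_set ?_
        rintro f ⟨⟨⟨⟨g1, g2⟩, ⟨g3, g4⟩⟩, g5⟩, g6⟩
        have k1 : f ∈ Stay D (t + m) := mem_stay_add.2 ⟨g1, g2⟩
        refine ⟨⟨k1, fun h => g4 (mem_stay_add.1 h).2⟩, ?_⟩
        refine mem_stay_add.2 ⟨mem_stay_add.2 ⟨mem_stay_add.2 ⟨?_, ?_⟩, ?_⟩, g6⟩
        · exact stay_mono Set.subset_union_left _ k1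
        · exact stay_mono Set.subset_union_right _ g3
        · exact stay_mono Set.subset_union_left _ g5

lemma exists_le_lintegral_diff {D U : Set ℂ} (hDo : IsOpen D) (hDc : IsPreconnected D)
    (hUo : IsOpen U) (hUc : IsPreconnected U) {H : ℝ} (hH : 0 ≤ H)
    (hHD : {x : ℂ | H < x.im} ⊆ D) (hlog : ∀ w ∈ U \ D, LogOnCompacts D w)
    (hUD : (U ∩ D).Nonempty) (hUD' : ¬ U ⊆ D) :
    ∃ c : ℝ, 0 < c ∧ ∀ᶠ y : ℝ in atTop, ∀ᶠ n : ℕ in atTop, ENNReal.ofReal (c / y) ≤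
      ∫⁻ f in Stay (D ∪ U) n \ Stay D n, ENNReal.ofReal (f.1 n).im
        ∂BM.law ((y : ℂ) * Complex.I) := by
  obtain ⟨w, hwU, hwD⟩ : (U ∩ frontier D).Nonempty := by
    by_contra hne
    refine hUD' (hUc.subset_left_of_subset_union hDo isClosed_closure.isOpen_compl
      (Set.disjoint_left.2 fun x hx hx' => hx' (subset_closure hx)) (fun x hx => ?_) hUD)
    by_contra hx'
    rw [Set.mem_union, Set.mem_compl_iff, not_or, not_not] at hx'
    exact hne ⟨x, hx, by rw [hDo.frontier_eq]; exact ⟨hx'.2, hx'.1⟩⟩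
  have hwD' : w ∉ D := fun h => by
    rw [hDo.frontier_eq] at hwD
    exact hwD.2 h
  obtain ⟨a, ha, haU⟩ := Metric.isOpen_iff.1 hUo w hwU
  obtain ⟨v, hvD, hv⟩ := Metric.mem_closure_iff.1 (frontier_subset_closure hwD) a ha
  rw [dist_comm] at hv
  obtain ⟨q, m, T, t₀, hq, h⟩ := BM.exists_le_lintegral_window hDo hDc hUo hH hHD hwD'
    (hlog w ⟨hwU, hwD'⟩) haU hv hvD
  set L : ℝ≥0 := T + 1 with hL
  have hL0 : (0 : ℝ) < L := by rw [hL]; push_cast; positivity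
  refine ⟨q / (2 * L), by positivity, ?_⟩
  filter_upwards [eventually_ge_atTop (2 * H + 6), eventually_ge_atTop (2 * (L : ℝ))] with y hy hyL
  have hy1 : 6 ≤ y := by linarith
  have hy0 : 0 < y := by linarith
  obtain ⟨n₀, hn₀⟩ := exists_nat_ge ((2 * y ^ 2).toNNReal + m + T + t₀)
  filter_upwards [eventually_ge_atTop n₀] with n hn
  set x : ℝ := y ^ 2 / L with hx
  have hx2 : 2 ≤ x := by
    rw [hx, le_div_iff₀ hL0]; nlinarith
  set I := Finset.Icc ⌈x⌉₊ ⌊2 * x⌋₊ with hI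
  have hcard : x / 2 ≤ (I.card : ℝ) := by
    rw [hI, Nat.card_Icc]
    have c1 := Nat.ceil_lt_add_one (show 0 ≤ x by linarith)
    have c2 := Nat.lt_floor_add_one (2 * x)
    have c3 : ((⌊2 * x⌋₊ + 1 : ℕ) : ℝ) ≤ ((⌊2 * x⌋₊ + 1 - ⌈x⌉₊ : ℕ) : ℝ) + (⌈x⌉₊ : ℕ) := by
      have : ⌊2 * x⌋₊ + 1 ≤ (⌊2 * x⌋₊ + 1 - ⌈x⌉₊) + ⌈x⌉₊ := by omega
      exact_mod_cast this
    push_cast at c3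
    linarith
  have hkx : ∀ k ∈ I, y ^ 2 ≤ (k * L : ℝ≥0) ∧ ((k * L : ℝ≥0) : ℝ) ≤ 2 * y ^ 2 := by
    intro k hk
    rw [hI, Finset.mem_Icc] at hk
    have k1 := Nat.ceil_le.1 hk.1
    have k2 := (Nat.le_floor_iff (show 0 ≤ 2 * x by linarith)).1 hk.2
    rw [hx, div_le_iff₀ hL0] at k1
    rw [hx, ← mul_div_assoc, le_div_iff₀ hL0] at k2
    push_cast
    exact ⟨k1, k2⟩
  have hkn : ∀ k ∈ I, (k * L : ℝ≥0) + m + T + t₀ ≤ n := by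
    intro k hk
    refine le_trans ?_ (hn₀.trans (Nat.cast_le.2 hn))
    gcongr
    exact NNReal.le_toNNReal_of_coe_le (hkx k hk).2
  have hDU : IsOpen (D ∪ U) := hDo.union hUo
  set W : ℕ → Set CPath := fun k => window D T (k * L + m) ∩ Stay (D ∪ U) n with hW
  have hWm : ∀ k ∈ I, MeasurableSet (W k) := fun k _ =>
    ((measurableSet_stay hDo _).diff (measurableSet_stay hDo _)).inter (measurableSet_stay hDU _)
  have hlt : ∀ k l : ℕ, k < l → Disjoint (W k) (W l) := by
    intro k l hkl
    refine Set.disjoint_left.2 fun f hk hl => hk.1.2 (stay_anti D ?_ hl.1.1)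
    have : (k : ℝ≥0) + 1 ≤ l := by exact_mod_cast hkl
    calc (k : ℝ≥0) * L + m + T ≤ (k : ℝ≥0) * L + m + L := by gcongr; rw [hL]; simp
      _ = (k + 1) * L + m := by ring
      _ ≤ _ := by gcongr
  have hWd : Set.PairwiseDisjoint (↑I) W := by
    intro k _ l _ hkl
    rcases lt_or_gt_of_ne hkl with h' | h'
    · exact hlt _ _ h'
    · exact (hlt _ _ h').symm
  have hsub : (⋃ k ∈ I, W k) ⊆ Stay (D ∪ U) n \ Stay D n := by
    refine Set.iUnion₂_subset fun k hk f hf => ⟨hf.2, fun hfn => hf.1.2 (stay_anti D ?_ hfn)⟩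
    exact le_trans (by simp) (hkn k hk)
  refine le_trans ?_ (lintegral_mono_set hsub)
  rw [lintegral_biUnion_finset hWd hWm]
  calc ENNReal.ofReal (q / (2 * L) / y) = ENNReal.ofReal (x / 2 * (q / y ^ 3)) := by
        congr 1; rw [hx]; field_simp
    _ ≤ ENNReal.ofReal (I.card * (q / y ^ 3)) := ENNReal.ofReal_le_ofReal (by gcongr)
    _ = ∑ k ∈ I, ENNReal.ofReal (q / y ^ 3) := by
        rw [Finset.sum_const, nsmul_eq_mul, ENNReal.ofReal_mul (by positivity),
          ENNReal.ofReal_natCast]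
    _ ≤ _ := Finset.sum_le_sum fun k hk => by
        have := h y hy (k * L) (hkx k hk).1 (hkx k hk).2 (n - (k * L + m + T + t₀))
        rwa [add_tsub_cancel_of_le (hkn k hk)] at this

lemma exists_add_le_hcap {D U : Set ℂ} (hDo : IsOpen D) (hDc : IsPreconnected D)
    (hUo : IsOpen U) (hUc : IsPreconnected U) {H : ℝ} (hH : 0 ≤ H)
    (hHD : {x : ℂ | H < x.im} ⊆ D) (hlog : ∀ w ∈ U \ D, LogOnCompacts D w)
    (hUD : (U ∩ D).Nonempty) (hUD' : ¬ U ⊆ D) :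
    ∃ c : ℝ, 0 < c ∧ ∀ G G' : Set ℂ, G ⊆ G' → G' ⊆ UH → IsOpen (UH \ G) → IsOpen (UH \ G') →
      (∀ x ∈ G', x.im ≤ H) → D ∪ U ⊆ UH \ G → UH \ G' ⊆ D → ∀ a a' : ℝ, HasHcap BM G a →
      HasHcap BM G' a' → a + c ≤ a' := by
  obtain ⟨c, hc, hev⟩ := BM.exists_le_lintegral_diff hDo hDc hUo hUc hH hHD hlog hUD hUD'
  refine ⟨c, hc, fun G G' hGG' hG' hGo hGo' hGH hDG hGD a a' ha ha' => ?_⟩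
  refine le_of_tendsto_of_tendsto (ha.add_const c) ha' ?_
  filter_upwards [hev, eventually_gt_atTop H] with y hy hyH
  have hy0 : 0 < y := by linarith
  have hz : (y : ℂ) * Complex.I ∈ UH \ G' := by
    refine ⟨by simpa [UH] using hy0, fun h => ?_⟩
    have := hGH _ h
    simp at this
    linarith
  have := BM.add_le_integral_imAtHit hGG' hG' hGo hGo' hH hGH hz (δ := c / y) (by
    filter_upwards [hy] with n hn
    refine hn.trans (lintegral_mono_set ?_)
    exact Set.sdiff_subset_sdiff (stay_mono hDG _) (stay_mono hGD _))
  have h2 := mul_le_mul_of_nonneg_left this hy0.le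
  rw [mul_add, mul_div_cancel₀ _ hy0.ne'] at h2
  exact h2

end PlanarBM

namespace IsHHull

variable {F : Set ℂ}

lemma isOpen_diff (hF : IsHHull F) : IsOpen (UH \ F) := by
  have : UH \ F = UH \ closure F := by
    conv_lhs => rw [← hF.2.1]
    rw [Set.inter_comm, Set.sdiff_self_inter]
  rw [this]
  exact CPath.isOpen_UH.sdiff isClosed_closure

lemma isPreconnected_diff (hF : IsHHull F) : IsPreconnected (UH \ F) := by
  have := hF.2.2
  exact (isPathConnected_iff_pathConnectedSpace.2 inferInstance).isConnected.isPreconnected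

lemma logOnCompacts (hF : IsHHull F) {w : ℂ} (hw : w ∉ UH \ F) : LogOnCompacts (UH \ F) w := by
  obtain ⟨g, hg, hg'⟩ := Complex.exists_continuousOn_eqOn_exp_comp (g := fun z => z - w)
    (show IsSimplyConnected (UH \ F) from hF.2.2) hF.isOpen_diff (by fun_prop)
    (by rintro ⟨z, hz, h⟩; exact hw (sub_eq_zero.1 h ▸ hz))
  exact fun K _ hK => ⟨g, hg.mono hK, fun z hz => hg' (hK hz)⟩

end IsHHull

/-- A compact set contained in an increasing union of open sets is eventually contained in them. -/
lemma IsCompact.eventually_subset_of_monotone {X : Type*} [TopologicalSpace X] {K : Set X}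
    (hK : IsCompact K) {V : ℕ → Set X} (hVo : ∀ n, IsOpen (V n)) (hV : Monotone V)
    (h : K ⊆ ⋃ n, V n) : ∀ᶠ n in atTop, K ⊆ V n := by
  obtain ⟨n, hn⟩ := hK.elim_directed_cover V hVo h hV.directed_le
  exact (eventually_ge_atTop n).mono fun m hm => hn.trans (hV hm)

/-- Partial converse of the continuity of half-plane capacity: for a monotone
sequence of ℍ-hulls contained in a hull `Ftil` with bounded imaginary part and
finite capacity, convergence `hcap (F n) → hcap Finf` implies Carathéodory
convergence `F n → Finf`. -/
theorem hcap_convergence_implies_caratheodory {Ω : Type*} [MeasurableSpace Ω]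
    (BM : PlanarBM Ω) (Ftil : Set ℂ) (F : ℕ → Set ℂ) (Finf : Set ℂ)
    (hFtil : IsHHull Ftil) (hIm : BddAbove (Complex.im '' Ftil))
    (hfin : ∃ c, HasHcap BM Ftil c)
    (hF : ∀ n, IsHHull (F n)) (hFinf : IsHHull Finf)
    (hsub : ∀ n, F n ⊆ Ftil) (hsubinf : Finf ⊆ Ftil)
    (hmono : (Monotone F ∧ ∀ n, F n ⊆ Finf) ∨ (Antitone F ∧ ∀ n, Finf ⊆ F n))
    (a : ℕ → ℝ) (ainf : ℝ)
    (ha : ∀ n, HasHcap BM (F n) (a n)) (hainf : HasHcap BM Finf ainf)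
    (hconv : Tendsto a atTop (nhds ainf)) :
    ∀ z₀ ∈ UH \ Ftil, KernelConvergesTo (fun n => UH \ F n) (UH \ Finf) z₀ := by

  intro z₀ hz₀
  obtain ⟨H₀, hH₀⟩ := hIm
  set H := max H₀ 0
  have hH : 0 ≤ H := le_max_right _ _
  have hFH : ∀ x ∈ Ftil, x.im ≤ H := fun x hx =>
    (hH₀ (Set.mem_image_of_mem _ hx)).trans (le_max_left _ _)
  have hHD : ∀ G, G ⊆ Ftil → {x : ℂ | H < x.im} ⊆ UH \ G := fun G hG x (hx : H < x.im) =>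
    ⟨hH.trans_lt hx, fun hxG => (hFH x (hG hxG)).not_gt hx⟩
  have hz : ∀ G, G ⊆ Ftil → z₀ ∈ UH \ G := fun G hG => ⟨hz₀.1, fun h => hz₀.2 (hG h)⟩
  rcases hmono with ⟨hm, hle⟩ | ⟨hm, hle⟩
  · refine ⟨fun K _ hKi => .of_forall fun n => hKi.trans (Set.sdiff_subset_sdiff_right (hle n)),
      fun U hUo hUc hzU hinf => ?_⟩
    have hU : ∀ n, U ⊆ UH \ F n := fun n => by
      obtain ⟨k, hk, hnk⟩ := hinf.exists_gt n
      exact Set.Subset.trans hk (Set.sdiff_subset_sdiff_right (hm hnk.le))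
    by_contra hUD
    obtain ⟨c, hc, h⟩ := BM.exists_add_le_hcap hFinf.isOpen_diff hFinf.isPreconnected_diff hUo
      hUc.isPreconnected hH (hHD _ hsubinf) (fun w hw => hFinf.logOnCompacts hw.2)
      ⟨z₀, hzU, hz _ hsubinf⟩ hUD
    have h' : ∀ n, a n + c ≤ ainf := fun n => h (F n) Finf (hle n) hFinf.1 (hF n).isOpen_diff
      hFinf.isOpen_diff (fun x hx => hFH x (hsubinf hx))
      (Set.union_subset (Set.sdiff_subset_sdiff_right (hle n)) (hU n)) subset_rfl _ _ (ha n) hainf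
    have := le_of_tendsto' (hconv.add_const c) h'
    linarith
  · have hV : Monotone fun n => UH \ F n := fun m n hmn => Set.sdiff_subset_sdiff_right (hm hmn)
    refine ⟨fun K hK hKi => ?_, fun U hUo hUc hzU hinf => ?_⟩
    · set D := ⋃ n, UH \ F n with hD
      have hsubD : ∀ n, UH \ F n ⊆ D := Set.subset_iUnion fun n => UH \ F n
      refine hK.eventually_subset_of_monotone (fun n => (hF n).isOpen_diff) hV (hKi.trans ?_)
      by_contra hUD
      have hDo : IsOpen D := isOpen_iUnion fun n => (hF n).isOpen_diff
      have hDc : IsPreconnected D := isPreconnected_iUnion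
        ⟨z₀, Set.mem_iInter.2 fun n => hz _ (hsub n)⟩ fun n => (hF n).isPreconnected_diff
      have hlog : ∀ w ∈ (UH \ Finf) \ D, LogOnCompacts D w := fun w hw K' hK' hKD => by
        obtain ⟨n, hn⟩ := (hK'.eventually_subset_of_monotone
          (fun n => (hF n).isOpen_diff) hV hKD).exists
        exact (hF n).logOnCompacts (fun h => hw.2 (hsubD n h)) K' hK' hn
      obtain ⟨c, hc, h⟩ := BM.exists_add_le_hcap hDo hDc hFinf.isOpen_diff
        hFinf.isPreconnected_diff hH ((hHD _ (hsub 0)).trans (hsubD 0)) hlog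
        ⟨z₀, hz _ hsubinf, hsubD 0 (hz _ (hsub 0))⟩ hUD
      have h' : ∀ n, ainf + c ≤ a n := fun n => h Finf (F n) (hle n) (hF n).1 hFinf.isOpen_diff
        (hF n).isOpen_diff (fun x hx => hFH x (hsub n hx))
        (Set.union_subset (Set.iUnion_subset fun k => Set.sdiff_subset_sdiff_right (hle k))
          subset_rfl) (hsubD n) _ _ hainf (ha n)
      have := ge_of_tendsto' hconv h'
      linarith
    · obtain ⟨n, hn⟩ := hinf.nonempty
      exact Set.Subset.trans hn (Set.sdiff_subset_sdiff_right (hle n))
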